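/- arXiv:1706.08236 — 3 statements merged into one kernel-verified Lean document; each statement's English description precedes it below -/
import Mathlib

section
/- Let $a < b$ be real numbers and let $f : (a,b) \to \mathbb{R}$ be a bounded Borel function. Then $f$ is matrix monotone on $(a,b)$ if and only if $f$ is real analytic on $(a,b)$ and there exists a continuous function $F : \Pi \cup (a,b) \to \mathbb{C}$ such that $F$ is holomorphic on $\Pi$, $F$ agrees with $f$ on $(a,b)$, and $\operatorname{Im} F(z) \geq 0$ for every $z \in \Pi$ (i.e. $F$ maps $\Pi \cup (a,b)$ into $\overline{\Pi}$). -/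
open Matrix
open scoped ComplexOrder

/-- The functional calculus applied to a Hermitian matrix: writing
`A = U diag(λ₁,…,λₙ) U*` with `U` unitary, `f(A) = U diag(f(λ₁),…,f(λₙ)) U*`. -/
noncomputable def hermApply {n : ℕ} (f : ℝ → ℝ) {A : Matrix (Fin n) (Fin n) ℂ}
    (hA : A.IsHermitian) : Matrix (Fin n) (Fin n) ℂ :=
  (hA.eigenvectorUnitary : Matrix (Fin n) (Fin n) ℂ) *
    Matrix.diagonal (fun i => (f (hA.eigenvalues i) : ℂ)) *
    (star hA.eigenvectorUnitary : Matrix (Fin n) (Fin n) ℂ)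

/-- `f` is matrix monotone on `(a, b)`: for every `n` and every pair of Hermitian
`n × n` matrices `A ≤ B` with all eigenvalues in `(a, b)`, we have `f(A) ≤ f(B)`. -/
def MatrixMonotoneOn (f : ℝ → ℝ) (a b : ℝ) : Prop :=
  ∀ (n : ℕ) (A B : Matrix (Fin n) (Fin n) ℂ) (hA : A.IsHermitian) (hB : B.IsHermitian),
    (∀ i, hA.eigenvalues i ∈ Set.Ioo a b) → (∀ i, hB.eigenvalues i ∈ Set.Ioo a b) →
    (B - A).PosSemidef → (hermApply f hB - hermApply f hA).PosSemidef

lemma hermApply_eq_cfc {n : ℕ} (f : ℝ → ℝ) {A : Matrix (Fin n) (Fin n) ℂ} (hA : A.IsHermitian) :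
    hermApply f hA = cfc f A := by
  rw [hA.cfc_eq, Matrix.IsHermitian.cfc, Unitary.conjStarAlgAut_apply]
  rfl

lemma isHermitian_hermApply {n : ℕ} (f : ℝ → ℝ) {A : Matrix (Fin n) (Fin n) ℂ}
    (hA : A.IsHermitian) : (hermApply f hA).IsHermitian := by
  rw [hermApply_eq_cfc]
  exact cfc_predicate f A

/-- The quadratic form `v ↦ ⟨v, f(A) v⟩`, as a positive combination of values of `f`. -/
noncomputable def quadApply {n : ℕ} (f : ℝ → ℝ) {A : Matrix (Fin n) (Fin n) ℂ}
    (hA : A.IsHermitian) (v : Fin n → ℂ) : ℝ :=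
  ∑ i, ‖(star (hA.eigenvectorUnitary : Matrix (Fin n) (Fin n) ℂ) *ᵥ v) i‖ ^ 2 *
    f (hA.eigenvalues i)

lemma star_dotProduct_hermApply_mulVec {n : ℕ} (f : ℝ → ℝ) {A : Matrix (Fin n) (Fin n) ℂ}
    (hA : A.IsHermitian) (v : Fin n → ℂ) :
    star v ⬝ᵥ (hermApply f hA *ᵥ v) = (quadApply f hA v : ℂ) := by
  set U := (hA.eigenvectorUnitary : Matrix (Fin n) (Fin n) ℂ) with hU
  have h1 : star v ⬝ᵥ (hermApply f hA *ᵥ v) = star (star U *ᵥ v) ⬝ᵥ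
      (Matrix.diagonal (fun i => (f (hA.eigenvalues i) : ℂ)) *ᵥ (star U *ᵥ v)) := by
    rw [star_mulVec, ← dotProduct_mulVec, hermApply, mulVec_mulVec, mulVec_mulVec,
      star_eq_conjTranspose, conjTranspose_conjTranspose]
  rw [h1, quadApply, dotProduct]
  push_cast
  refine Finset.sum_congr rfl fun i _ => ?_
  rw [mulVec_diagonal, Pi.star_apply, ← Complex.conj_mul']
  simp only [RCLike.star_def]
  ring

lemma posSemidef_hermApply_sub_iff {n : ℕ} {f g : ℝ → ℝ} {A B : Matrix (Fin n) (Fin n) ℂ}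
    (hA : A.IsHermitian) (hB : B.IsHermitian) :
    (hermApply f hB - hermApply g hA).PosSemidef ↔
      ∀ v, quadApply g hA v ≤ quadApply f hB v := by
  rw [posSemidef_iff_dotProduct_mulVec]
  have key : ∀ v, star v ⬝ᵥ ((hermApply f hB - hermApply g hA) *ᵥ v) =
      ((quadApply f hB v - quadApply g hA v : ℝ) : ℂ) := fun v => by
    rw [sub_mulVec, dotProduct_sub, star_dotProduct_hermApply_mulVec,
      star_dotProduct_hermApply_mulVec, Complex.ofReal_sub]
  constructor
  · rintro ⟨-, h⟩ v
    have := h v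
    rw [key] at this
    simpa using this
  · intro h
    refine ⟨(isHermitian_hermApply f hB).sub (isHermitian_hermApply g hA), fun v => ?_⟩
    rw [key]
    simpa using h v

/-- A pointwise limit of matrix monotone functions is matrix monotone. -/
lemma MatrixMonotoneOn.of_tendsto {ι : Type*} {l : Filter ι} [l.NeBot] {a b : ℝ}
    {g : ι → ℝ → ℝ} {f : ℝ → ℝ} (hg : ∀ᶠ i in l, MatrixMonotoneOn (g i) a b)
    (h : ∀ x ∈ Set.Ioo a b, Filter.Tendsto (fun i => g i x) l (nhds (f x))) :
    MatrixMonotoneOn f a b := by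
  intro n A B hA hB sA sB hAB
  rw [posSemidef_hermApply_sub_iff]
  intro v
  refine le_of_tendsto_of_tendsto
    (tendsto_finsetSum _ fun i _ => (h _ (sA i)).const_mul _)
    (tendsto_finsetSum _ fun i _ => (h _ (sB i)).const_mul _) (hg.mono fun i hi => ?_)
  exact (posSemidef_hermApply_sub_iff hA hB).1 (hi n A B hA hB sA sB hAB) v

/-- Integrals of matrix monotone functions against a positive measure are matrix monotone. -/
lemma MatrixMonotoneOn.integral {T : Type*} [MeasurableSpace T] {μ : MeasureTheory.Measure T}
    {a b : ℝ} {g : T → ℝ → ℝ} (hg : ∀ᵐ t ∂μ, MatrixMonotoneOn (g t) a b)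
    (hi : ∀ x ∈ Set.Ioo a b, MeasureTheory.Integrable (fun t => g t x) μ) :
    MatrixMonotoneOn (fun x => ∫ t, g t x ∂μ) a b := by
  intro n A B hA hB sA sB hAB
  rw [posSemidef_hermApply_sub_iff]
  intro v
  have key : ∀ (C : Matrix (Fin n) (Fin n) ℂ) (hC : C.IsHermitian),
      (∀ i, hC.eigenvalues i ∈ Set.Ioo a b) →
      MeasureTheory.Integrable (fun t => quadApply (g t) hC v) μ ∧
      quadApply (fun x => ∫ t, g t x ∂μ) hC v = ∫ t, quadApply (g t) hC v ∂μ := by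
    intro C hC sC
    have h1 := fun i (_ : i ∈ Finset.univ) => (hi _ (sC i)).const_mul
      (‖(star (hC.eigenvectorUnitary : Matrix (Fin n) (Fin n) ℂ) *ᵥ v) i‖ ^ 2)
    refine ⟨MeasureTheory.integrable_finsetSum _ h1, ?_⟩
    simp only [quadApply]
    rw [MeasureTheory.integral_finsetSum _ h1]
    simp only [MeasureTheory.integral_const_mul]
  rw [(key A hA sA).2, (key B hB sB).2]
  refine MeasureTheory.integral_mono_ae (key A hA sA).1 (key B hB sB).1 ?_
  filter_upwards [hg] with t ht
  exact (posSemidef_hermApply_sub_iff hA hB).1 (ht n A B hA hB sA sB hAB) v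

lemma MatrixMonotoneOn.congr {a b : ℝ} {f g : ℝ → ℝ} (hf : MatrixMonotoneOn f a b)
    (h : ∀ x ∈ Set.Ioo a b, f x = g x) : MatrixMonotoneOn g a b :=
  MatrixMonotoneOn.of_tendsto (l := Filter.atTop (α := ℕ)) (g := fun _ => f)
    (Filter.Eventually.of_forall fun _ => hf) fun x hx => by
      rw [h x hx]; exact tendsto_const_nhds

lemma MatrixMonotoneOn.const_mul {a b c : ℝ} {f : ℝ → ℝ} (hf : MatrixMonotoneOn f a b)
    (hc : 0 ≤ c) : MatrixMonotoneOn (fun x => c * f x) a b := by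
  intro n A B hA hB sA sB hAB
  rw [posSemidef_hermApply_sub_iff]
  intro v
  have h := (posSemidef_hermApply_sub_iff hA hB).1 (hf n A B hA hB sA sB hAB) v
  have key : ∀ (C : Matrix (Fin n) (Fin n) ℂ) (hC : C.IsHermitian),
      quadApply (fun x => c * f x) hC v = c * quadApply f hC v := fun C hC => by
    simp only [quadApply, Finset.mul_sum]
    exact Finset.sum_congr rfl fun i _ => by ring
  rw [key, key]
  exact mul_le_mul_of_nonneg_left h hc

lemma MatrixMonotoneOn.add_const {a b : ℝ} {f : ℝ → ℝ} (hf : MatrixMonotoneOn f a b) (c : ℝ) :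
    MatrixMonotoneOn (fun x => f x + c) a b := by
  intro n A B hA hB sA sB hAB
  have key : ∀ (C : Matrix (Fin n) (Fin n) ℂ) (hC : C.IsHermitian),
      hermApply (fun x => f x + c) hC = hermApply f hC + algebraMap ℝ _ c := fun C hC => by
    rw [hermApply_eq_cfc, hermApply_eq_cfc, cfc_add_const c f C
      (by rw [continuousOn_iff_continuous_domRestrict]; fun_prop) hC.isSelfAdjoint]
  rw [key, key, add_sub_add_right_eq_sub]
  exact hf n A B hA hB sA sB hAB

lemma forall_eigenvalues_mem_iff {n : ℕ} {A : Matrix (Fin n) (Fin n) ℂ} (hA : A.IsHermitian)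
    {s : Set ℝ} : (∀ i, hA.eigenvalues i ∈ s) ↔ spectrum ℝ A ⊆ s := by
  rw [hA.spectrum_real_eq_range_eigenvalues, Set.range_subset_iff]

lemma matrixMonotoneOn_iff_cfc {f : ℝ → ℝ} {a b : ℝ} : MatrixMonotoneOn f a b ↔
    ∀ (n : ℕ) (A B : Matrix (Fin n) (Fin n) ℂ), A.IsHermitian → B.IsHermitian →
      spectrum ℝ A ⊆ Set.Ioo a b → spectrum ℝ B ⊆ Set.Ioo a b → (B - A).PosSemidef →
      (cfc f B - cfc f A).PosSemidef := by
  constructor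
  · intro h n A B hA hB sA sB hAB
    have := h n A B hA hB ((forall_eigenvalues_mem_iff hA).2 sA)
      ((forall_eigenvalues_mem_iff hB).2 sB) hAB
    rwa [hermApply_eq_cfc, hermApply_eq_cfc] at this
  · intro h n A B hA hB sA sB hAB
    rw [hermApply_eq_cfc, hermApply_eq_cfc]
    exact h n A B hA hB ((forall_eigenvalues_mem_iff hA).1 sA)
      ((forall_eigenvalues_mem_iff hB).1 sB) hAB

lemma MatrixMonotoneOn.comp_affine {a b a' b' : ℝ} {f : ℝ → ℝ} (hf : MatrixMonotoneOn f a b)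
    {m r : ℝ} (hr : 0 ≤ r) (h : ∀ x ∈ Set.Ioo a' b', r * x + m ∈ Set.Ioo a b) :
    MatrixMonotoneOn (fun x => f (r * x + m)) a' b' := by
  rw [matrixMonotoneOn_iff_cfc] at hf ⊢
  intro n A B hA hB sA sB hAB
  have key : ∀ C : Matrix (Fin n) (Fin n) ℂ, C.IsHermitian → spectrum ℝ C ⊆ Set.Ioo a' b' →
      (cfc (fun x => r * x + m) C).IsHermitian ∧
      cfc (fun x => r * x + m) C = r • C + algebraMap ℝ _ m ∧
      spectrum ℝ (cfc (fun x => r * x + m) C) ⊆ Set.Ioo a b ∧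
      cfc (fun x => f (r * x + m)) C = cfc f (cfc (fun x => r * x + m) C) := by
    intro C hC sC
    have hC' : IsSelfAdjoint C := hC
    have hfin : (spectrum ℝ C).Finite := by
      rw [hC.spectrum_real_eq_range_eigenvalues]; exact Set.finite_range _
    refine ⟨cfc_predicate _ C, ?_, ?_, ?_⟩
    · rw [cfc_add_const m (fun x => r * x) C (by fun_prop) hC', cfc_const_mul r (fun x => x) C,
        cfc_id' ℝ C]
    · rw [cfc_map_spectrum (fun x => r * x + m) C hC' (by fun_prop)]
      rintro _ ⟨x, hx, rfl⟩
      exact h x (sC hx)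
    · exact cfc_comp' f (fun x => r * x + m) C ((hfin.image _).continuousOn _)
        (by fun_prop) hC'
  obtain ⟨a1, a2, a3, a4⟩ := key A hA sA
  obtain ⟨b1, b2, b3, b4⟩ := key B hB sB
  rw [a4, b4]
  refine hf n _ _ a1 b1 a3 b3 ?_
  rw [a2, b2, add_sub_add_right_eq_sub, ← smul_sub]
  exact hAB.smul hr

lemma Matrix.PosDef.inv_sub_inv_posSemidef {n : Type*} [Fintype n] [DecidableEq n]
    {P Q : Matrix n n ℂ} (hP : P.PosDef) (hPQ : (Q - P).PosSemidef) :
    (P⁻¹ - Q⁻¹).PosSemidef := by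
  have hQ : Q.PosDef := by simpa using hP.add_posSemidef hPQ
  have := hP.isUnit.invertible
  have := hQ.isUnit.invertible
  have h1 : (fromBlocks P 1 (1)ᴴ P⁻¹).PosSemidef := by
    rw [hP.fromBlocks₁₁]; simpa using PosSemidef.zero
  have h2 : (fromBlocks (Q - P) 0 0 (0 : Matrix n n ℂ)).PosSemidef := by
    rw [posSemidef_iff_dotProduct_mulVec] at hPQ ⊢
    refine ⟨by simpa [IsHermitian, fromBlocks_conjTranspose] using hPQ.1.eq, fun x => ?_⟩
    have := hPQ.2 (x ∘ Sum.inl)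
    simpa [fromBlocks_mulVec, dotProduct, Fintype.sum_sum_type] using this
  have h3 := h1.add h2
  rw [fromBlocks_add] at h3
  have h4 : (fromBlocks Q 1 (1)ᴴ P⁻¹).PosSemidef := by simpa using h3
  rw [hQ.fromBlocks₁₁] at h4
  simpa using h4

lemma posDef_one_sub_smul {n : ℕ} {A : Matrix (Fin n) (Fin n) ℂ} (hA : A.IsHermitian)
    (sA : spectrum ℝ A ⊆ Set.Ioo (-1) 1) {c : ℝ} (hc : |c| ≤ 1) :
    (cfc (fun x : ℝ => 1 - c * x) A).PosDef ∧
      cfc (fun x : ℝ => 1 - c * x) A = 1 - c • A ∧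
      cfc (fun x : ℝ => (1 - c * x)⁻¹) A = (cfc (fun x : ℝ => 1 - c * x) A)⁻¹ := by
  have hA' : IsSelfAdjoint A := hA
  have hpos : ∀ x ∈ spectrum ℝ A, 0 < 1 - c * x := fun x hx => by
    have h1 := sA hx
    have : |c * x| < 1 := by
      rw [abs_mul]
      calc |c| * |x| ≤ 1 * |x| := by gcongr
        _ < 1 := by rw [one_mul, abs_lt]; exact h1
    linarith [(abs_lt.1 this).2]
  refine ⟨?_, ?_, ?_⟩
  · have hH : (cfc (fun x : ℝ => 1 - c * x) A).IsHermitian := cfc_predicate _ A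
    rw [hH.posDef_iff_eigenvalues_pos]
    intro i
    have := hH.eigenvalues_mem_spectrum_real i
    rw [cfc_map_spectrum (fun x : ℝ => 1 - c * x) A hA' (by fun_prop)] at this
    obtain ⟨x, hx, h⟩ := this
    rw [← h]
    exact hpos x hx
  · rw [cfc_sub (fun _ : ℝ => (1 : ℝ)) (fun x => c * x) A (by fun_prop) (by fun_prop),
      cfc_const_one ℝ A hA', cfc_const_mul c (fun x => x) A, cfc_id' ℝ A]
  · refine (Matrix.inv_eq_right_inv ?_).symm
    rw [← cfc_mul (fun x : ℝ => 1 - c * x) (fun x => (1 - c * x)⁻¹) A (by fun_prop)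
      (ContinuousOn.inv₀ (by fun_prop) fun x hx => (hpos x hx).ne')]
    rw [cfc_congr (g := fun _ => 1) (fun x hx => mul_inv_cancel₀ (hpos x hx).ne'),
      cfc_const_one ℝ A hA']

/-- The extremal matrix monotone functions on `(-1, 1)`. -/
lemma matrixMonotoneOn_div_one_sub {c : ℝ} (hc : |c| ≤ 1) :
    MatrixMonotoneOn (fun x => x / (1 - c * x)) (-1) 1 := by
  rcases eq_or_ne c 0 with rfl | hc0
  · rw [matrixMonotoneOn_iff_cfc]
    intro n A B hA hB sA sB hAB
    have hA' : IsSelfAdjoint A := hA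
    have hB' : IsSelfAdjoint B := hB
    simpa [cfc_id' ℝ A, cfc_id' ℝ B] using hAB
  have hinv : MatrixMonotoneOn (fun x => c⁻¹ * (1 - c * x)⁻¹) (-1) 1 := by
    rw [matrixMonotoneOn_iff_cfc]
    intro n A B hA hB sA sB hAB
    have key : ∀ C : Matrix (Fin n) (Fin n) ℂ, C.IsHermitian → spectrum ℝ C ⊆ Set.Ioo (-1) 1 →
        cfc (fun x : ℝ => c⁻¹ * (1 - c * x)⁻¹) C = c⁻¹ • (1 - c • C)⁻¹ ∧
          (1 - c • C).PosDef := by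
      intro C hC sC
      obtain ⟨h1, h2, h3⟩ := posDef_one_sub_smul hC sC hc
      have hfin : (spectrum ℝ C).Finite := by
        rw [hC.spectrum_real_eq_range_eigenvalues]; exact Set.finite_range _
      rw [cfc_const_mul _ _ C (hfin.continuousOn _), h3, ← h2]
      exact ⟨rfl, h1⟩
    obtain ⟨a1, a2⟩ := key A hA sA
    obtain ⟨b1, b2⟩ := key B hB sB
    rw [a1, b1, ← smul_sub]
    rcases hc0.lt_or_gt with h | h
    · have := (a2.inv_sub_inv_posSemidef (Q := 1 - c • B) (by
        have := hAB.smul (neg_nonneg.2 h.le)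
        convert this using 1
        rw [neg_smul, smul_sub]; abel)).smul (a := -c⁻¹) (by
          rw [← inv_neg]; exact inv_nonneg.2 (neg_nonneg.2 h.le))
      convert this using 1
      rw [neg_smul, smul_sub, smul_sub]; abel
    · refine (b2.inv_sub_inv_posSemidef (Q := 1 - c • A) (by
        have := hAB.smul h.le
        convert this using 1
        rw [smul_sub]; abel)).smul (inv_nonneg.2 h.le)
  refine (hinv.add_const (-c⁻¹)).congr fun x hx => ?_
  have : 0 < 1 - c * x := by
    have : |c * x| < 1 := by
      rw [abs_mul]
      calc |c| * |x| ≤ 1 * |x| := by gcongr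
        _ < 1 := by rw [one_mul, abs_lt]; exact hx
    linarith [(abs_lt.1 this).2]
  field_simp
  ring

section

open Complex Metric Set Filter Topology ComplexConjugate

/-- Cauchy's theorem on rectangles for continuous functions which are holomorphic off the real
axis. -/
lemma isConservativeOn_of_differentiableOn_off_real {f : ℂ → ℂ} {U : Set ℂ}
    (hc : ContinuousOn f U) (hd : ∀ z ∈ U, z.im ≠ 0 → DifferentiableAt ℂ f z) :
    IsConservativeOn f U := by
  have key : ∀ z w : ℂ, Rectangle z w ⊆ U → (0 : ℝ) ∉ Ioo (min z.im w.im) (max z.im w.im) →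
      wedgeIntegral z w f + wedgeIntegral w z f = 0 := by
    intro z w hzw h0
    rw [wedgeIntegral_add_wedgeIntegral_eq]
    refine integral_boundary_rect_eq_zero_of_continuousOn_of_differentiableOn f z w
      (hc.mono hzw) fun x hx => (hd x (hzw ?_) ?_).differentiableWithinAt
    · exact ⟨Ioo_subset_Icc_self hx.1, Ioo_subset_Icc_self hx.2⟩
    · intro hx0
      exact h0 (hx0 ▸ hx.2)
  intro z w hzw
  rw [← add_eq_zero_iff_eq_neg]
  by_cases h0 : (0 : ℝ) ∈ Ioo (min z.im w.im) (max z.im w.im)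
  swap
  · exact key z w hzw h0
  have h0' : (0 : ℝ) ∈ uIcc z.im w.im := Ioo_subset_Icc_self h0
  have s1 : Rectangle z (w.re : ℂ) ⊆ U := by
    refine Subset.trans ?_ hzw
    rintro x ⟨h1, h2⟩
    exact ⟨by simpa using h1, uIcc_subset_uIcc left_mem_uIcc h0' (by simpa using h2)⟩
  have s2 : Rectangle (z.re : ℂ) w ⊆ U := by
    refine Subset.trans ?_ hzw
    rintro x ⟨h1, h2⟩
    exact ⟨by simpa using h1, uIcc_subset_uIcc h0' right_mem_uIcc (by simpa using h2)⟩
  have e1 := key _ _ s1 (by simpa using fun h => le_of_lt h)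
  have e2 := key _ _ s2 (by simpa using fun h => le_of_lt h)
  rw [wedgeIntegral_add_wedgeIntegral_eq] at e1 e2 ⊢
  simp only [ofReal_re, ofReal_im] at e1 e2
  have vert : ∀ a ∈ uIcc z.re w.re, (∫ y : ℝ in z.im..w.im, f (a + y * I)) =
      (∫ y : ℝ in z.im..0, f (a + y * I)) + ∫ y : ℝ in (0 : ℝ)..w.im, f (a + y * I) := by
    intro a ha
    have hcv : ContinuousOn (fun y : ℝ => f (a + y * I)) (uIcc z.im w.im) := by
      refine hc.comp (by fun_prop) fun y hy => hzw ⟨by simpa using ha, by simpa using hy⟩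
    refine (intervalIntegral.integral_add_adjacent_intervals ?_ ?_).symm
    · exact (hcv.mono (uIcc_subset_uIcc left_mem_uIcc h0')).intervalIntegrable
    · exact (hcv.mono (uIcc_subset_uIcc h0' right_mem_uIcc)).intervalIntegrable
  rw [vert _ left_mem_uIcc, vert _ right_mem_uIcc]
  simp only [smul_eq_mul] at *
  linear_combination e1 + e2

lemma differentiableOn_ball_of_off_real {f : ℂ → ℂ} {U : Set ℂ} (hU : IsOpen U)
    (hc : ContinuousOn f U) (hd : ∀ z ∈ U, z.im ≠ 0 → DifferentiableAt ℂ f z) :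
    DifferentiableOn ℂ f U :=
  (isConservativeOn_and_continuousOn_iff_isDifferentiableOn hU).1
    ⟨isConservativeOn_of_differentiableOn_off_real hc hd, hc⟩

/-- The extension of a function on the upper half plane by Schwarz reflection. -/
noncomputable def schwarzReflection (φ : ℂ → ℂ) (z : ℂ) : ℂ :=
  if 0 ≤ z.im then φ z else conj (φ (conj z))

lemma differentiableOn_schwarzReflection {φ : ℂ → ℂ} {R : ℝ}
    (hc : ContinuousOn φ (ball 0 R ∩ {z | 0 ≤ z.im}))
    (hd : ∀ z ∈ ball (0 : ℂ) R, 0 < z.im → DifferentiableAt ℂ φ z)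
    (hr : ∀ z ∈ ball (0 : ℂ) R, z.im = 0 → (φ z).im = 0) :
    DifferentiableOn ℂ (schwarzReflection φ) (ball 0 R) := by
  refine differentiableOn_ball_of_off_real isOpen_ball ?_ fun z hz hz0 => ?_
  · refine ContinuousOn.if ?_ ?_ ?_
    · rintro z ⟨hz, hz'⟩
      rw [frontier_setOfPred_le_im] at hz'
      have h0 : z.im = 0 := hz'
      rw [conj_eq_iff_im.2 h0, conj_eq_iff_im.2 (hr z hz h0)]
    · rwa [(isClosed_le continuous_const continuous_im).closure_eq]
    · simp only [not_le]
      rw [closure_setOfPred_im_lt]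
      refine continuous_conj.comp_continuousOn (hc.comp continuous_conj.continuousOn ?_)
      rintro z ⟨hz, hz'⟩
      have h0 : z.im ≤ 0 := hz'
      exact ⟨by simpa using hz, by simpa using h0⟩
  · rcases hz0.lt_or_gt with h | h
    · have : DifferentiableAt ℂ (conj ∘ φ ∘ conj) z :=
        differentiableAt_conj_conj_iff.2 (hd (conj z) (by simpa using hz) (by simpa using h))
      refine this.congr_of_eventuallyEq ?_
      filter_upwards [(isOpen_lt continuous_im continuous_const).mem_nhds h] with x hx
      exact if_neg (not_le.2 hx)
    · refine (hd z hz h).congr_of_eventuallyEq ?_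
      filter_upwards [(isOpen_lt continuous_const continuous_im).mem_nhds h] with x hx
      exact if_pos (le_of_lt hx)

lemma robertson_kernel {z : ℂ} (hz : ‖z‖ = 1) {w : ℝ} (hw : |w| < 1) :
    0 < 1 + w ^ 2 - 2 * w * z.re ∧
    z / (z - w) - (1 - w * z)⁻¹ = ((-2 * w * z.im / (1 + w ^ 2 - 2 * w * z.re) : ℝ) : ℂ) * I := by
  have hz2 : z.re * z.re + z.im * z.im = 1 := by
    rw [← normSq_apply, normSq_eq_norm_sq, hz, one_pow]
  have hzre : |z.re| ≤ 1 := hz ▸ abs_re_le_norm z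
  have hD : 0 < 1 + w ^ 2 - 2 * w * z.re := by
    have h1 := abs_lt.1 hw
    have h2 : w * z.re ≤ |w| := (le_abs_self _).trans (by
      rw [abs_mul]; exact mul_le_of_le_one_right (abs_nonneg _) hzre)
    nlinarith [sq_abs w]
  refine ⟨hD, ?_⟩
  have hz0 : z ≠ 0 := fun h => by simp [h] at hz
  have hprod : (z - w) * (1 - w * z) = z * ((1 + w ^ 2 - 2 * w * z.re : ℝ) : ℂ) := by
    apply Complex.ext
    · simp [pow_two]
      linear_combination w * hz2
    · simp [pow_two]
      ring
  have hD' : ((1 + w ^ 2 - 2 * w * z.re : ℝ) : ℂ) ≠ 0 := ofReal_ne_zero.2 hD.ne'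
  have hne := hprod ▸ mul_ne_zero hz0 hD'
  have h1 := left_ne_zero_of_mul hne
  have h2 := right_ne_zero_of_mul hne
  have e : z / (z - w) - (1 - w * z)⁻¹ = (w * (1 - z ^ 2)) / ((z - w) * (1 - w * z)) := by
    rw [← one_div, div_sub_div _ _ h1 h2]
    congr 1
    ring
  have h3 : 1 - z ^ 2 = z * (-2 * z.im * I) := by
    apply Complex.ext <;> simp [pow_two] <;> linarith
  rw [e, hprod, h3, ofReal_div]
  field_simp
  push_cast
  ring

/-- Robertson's formula for typically real functions. -/
lemma re_sub_re_eq_circleAverage {G : ℂ → ℂ} {R : ℝ} (hR : 1 < R)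
    (hG : DifferentiableOn ℂ G (ball 0 R)) {w x : ℝ} (hw : |w| < 1)
    (hx : x = 2 * w / (1 + w ^ 2)) :
    (G w).re - (G 0).re =
      Real.circleAverage (fun z => z.im * (G z).im * (x / (1 - z.re * x))) 0 1 := by
  have hsub : closedBall (0 : ℂ) |1| ⊆ ball 0 R := by
    rw [abs_one]; exact closedBall_subset_ball hR
  have hcl : closure (ball (0 : ℂ) |1|) ⊆ ball 0 R := closure_ball_subset_closedBall.trans hsub
  have hwc : ∀ z ∈ closedBall (0 : ℂ) |1|, 1 - w * z ≠ 0 := by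
    intro z hz h
    rw [abs_one, mem_closedBall_zero_iff] at hz
    have : ‖(w : ℂ) * z‖ < 1 := by
      rw [norm_mul, norm_real, Real.norm_eq_abs]
      nlinarith [abs_nonneg w, norm_nonneg z]
    rw [← sub_eq_zero.1 h, norm_one] at this
    exact lt_irrefl _ this
  have hG1 : DiffContOnCl ℂ G (ball 0 |1|) := (hG.mono hcl).diffContOnCl
  have hG2 : DiffContOnCl ℂ (fun z : ℂ => (1 - w * z)⁻¹ • G z) (ball 0 |1|) := by
    refine DifferentiableOn.diffContOnCl ?_
    refine DifferentiableOn.smul (DifferentiableOn.inv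
      (h := fun z : ℂ => 1 - w * z) (by fun_prop) fun z hz => ?_) (hG.mono hcl)
    exact hwc z (closure_ball_subset_closedBall hz)
  have hsph : sphere (0 : ℂ) |1| ⊆ closedBall 0 |1| := sphere_subset_closedBall
  have e1 := hG1.circleAverage_smul_div (w := (w : ℂ)) (by simpa using hw)
  have e2 := hG2.circleAverage
  have hcG : ContinuousOn G (sphere 0 |1|) := hG.continuousOn.mono (hsph.trans hsub)
  have i1 : CircleIntegrable (fun z => ((z - 0) / (z - (w : ℂ))) • G z) 0 1 := by
    refine ContinuousOn.circleIntegrable' (ContinuousOn.smul (ContinuousOn.div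
      (f := fun z : ℂ => z - 0) (g := fun z : ℂ => z - w) (by fun_prop) (by fun_prop) fun z hz h => ?_) hcG)
    rw [sub_eq_zero.1 h] at hz
    simp at hz
    exact hw.ne hz
  have i2 : CircleIntegrable (fun z : ℂ => (1 - w * z)⁻¹ • G z) 0 1 := by
    refine ContinuousOn.circleIntegrable' (ContinuousOn.smul (ContinuousOn.inv₀
      (f := fun z : ℂ => 1 - w * z) (by fun_prop) fun z hz => hwc z (hsph hz)) hcG)
  have e3 := Real.circleAverage_sub i1 i2
  rw [e1, e2] at e3
  have e4 := reCLM.circleAverage_comp_comm (i1.sub i2)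
  rw [e3] at e4
  simp only [mul_zero, sub_zero, inv_one, one_smul, reCLM_apply, sub_re] at e4
  rw [← e4]
  refine Real.circleAverage_congr_sphere fun z hz => ?_
  obtain ⟨hD, hK⟩ := robertson_kernel (z := z) (by simpa using hz) hw
  have hw2 : 0 < 1 + w ^ 2 := by positivity
  simp only [Function.comp, reCLM_apply, Pi.sub_apply, smul_eq_mul]
  rw [← sub_mul, hK, mul_assoc, re_ofReal_mul, I_mul_re, hx]
  have : 1 - z.re * (2 * w / (1 + w ^ 2)) = (1 + w ^ 2 - 2 * w * z.re) / (1 + w ^ 2) := by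
    field_simp
  rw [this]
  field_simp

end

section

open Complex Metric Set Filter Topology ComplexConjugate

lemma joukowski_inverse {x : ℝ} (hx : x ∈ Ioo (-1 : ℝ) 1) :
    |x / (1 + √(1 - x ^ 2))| < 1 ∧
      x = 2 * (x / (1 + √(1 - x ^ 2))) / (1 + (x / (1 + √(1 - x ^ 2))) ^ 2) := by
  have h0 : 0 < 1 - x ^ 2 := by nlinarith [hx.1, hx.2]
  have hs : 0 < √(1 - x ^ 2) := Real.sqrt_pos.2 h0
  have hs2 : √(1 - x ^ 2) ^ 2 = 1 - x ^ 2 := Real.sq_sqrt h0.le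
  generalize √(1 - x ^ 2) = s at hs hs2
  have h1 : 0 < 1 + s := by linarith
  constructor
  · rw [abs_div, abs_of_pos h1, div_lt_one h1]
    have := abs_lt.2 hx
    linarith
  · have : 1 + (x / (1 + s)) ^ 2 = 2 / (1 + s) := by
      field_simp
      linarith
    rw [this]
    field_simp

lemma abs_re_mul_lt_one {z : ℂ} (hz : ‖z‖ = 1) {x : ℝ} (hx : x ∈ Ioo (-1 : ℝ) 1) :
    0 < 1 - z.re * x := by
  have hzre : |z.re| ≤ 1 := hz ▸ abs_re_le_norm z
  have h1 := abs_lt.2 hx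
  have h2 : z.re * x ≤ |x| := (le_abs_self _).trans (by
    rw [abs_mul]; exact mul_le_of_le_one_left (abs_nonneg _) hzre)
  linarith

lemma matrixMonotoneOn_of_typicallyReal {H : ℂ → ℂ} {R : ℝ} (hR : 1 < R)
    (hH : DifferentiableOn ℂ H (ball 0 R)) (hs : ∀ z ∈ ball (0 : ℂ) R, 0 ≤ z.im * (H z).im) :
    MatrixMonotoneOn (fun x => (H ((x / (1 + √(1 - x ^ 2)) : ℝ) : ℂ)).re) (-1) 1 := by
  have hcirc : ∀ θ, circleMap 0 1 θ ∈ ball (0 : ℂ) R := fun θ => by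
    simpa [circleMap_zero] using hR
  have hcH : Continuous fun θ => H (circleMap 0 1 θ) :=
    hH.continuousOn.comp_continuous (continuous_circleMap 0 1) hcirc
  have hmono : MatrixMonotoneOn (fun x => ∫ θ in Ioc 0 (2 * Real.pi),
      (circleMap 0 1 θ).im * (H (circleMap 0 1 θ)).im * (x / (1 - (circleMap 0 1 θ).re * x)))
      (-1) 1 := by
    refine MatrixMonotoneOn.integral (Eventually.of_forall fun θ => ?_) fun x hx => ?_
    · refine (matrixMonotoneOn_div_one_sub ?_).const_mul (hs _ (hcirc θ))
      refine (abs_re_le_norm _).trans ?_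
      simp [circleMap_zero]
    · have : Continuous fun θ => (circleMap 0 1 θ).im * (H (circleMap 0 1 θ)).im *
          (x / (1 - (circleMap 0 1 θ).re * x)) := by
        have hc := continuous_circleMap 0 1
        refine ((continuous_im.comp hc).mul (continuous_im.comp hcH)).mul
          (continuous_const.div (continuous_const.sub ((continuous_re.comp hc).mul
            continuous_const)) fun θ => (abs_re_mul_lt_one ?_ hx).ne')
        simp [circleMap_zero]
      exact (this.intervalIntegrable 0 (2 * Real.pi)).1
  refine ((hmono.const_mul (c := (2 * Real.pi)⁻¹) (by positivity)).add_const (H 0).re).congr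
    fun x hx => ?_
  obtain ⟨hw, hxw⟩ := joukowski_inverse hx
  have := re_sub_re_eq_circleAverage hR hH hw hxw
  rw [Real.circleAverage_def, intervalIntegral.integral_of_le (by positivity), smul_eq_mul] at this
  rw [← this]
  ring

lemma im_joukowski_pos {w : ℂ} (hw : ‖w‖ < 1) :
    1 + w ^ 2 ≠ 0 ∧ (2 * w / (1 + w ^ 2)).im = w.im * (2 * (1 - ‖w‖ ^ 2) / normSq (1 + w ^ 2)) := by
  constructor
  · intro h
    have : ‖w ^ 2‖ = 1 := by rw [eq_neg_of_add_eq_zero_right h]; simp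
    rw [norm_pow] at this
    nlinarith [norm_nonneg w]
  · rw [div_im, ← normSq_eq_norm_sq, normSq_apply w]
    simp [pow_two]
    ring

/-- A Pick function on the upper half plane with continuous real boundary values on `(-1, 1)` is
matrix monotone there. -/
lemma matrixMonotoneOn_of_pick {g : ℝ → ℝ} {F : ℂ → ℂ}
    (hc : ContinuousOn F ({z : ℂ | 0 < z.im} ∪ (Complex.ofReal '' Ioo (-1) 1)))
    (hd : DifferentiableOn ℂ F {z : ℂ | 0 < z.im})
    (hr : ∀ x ∈ Ioo (-1 : ℝ) 1, F (x : ℂ) = (g x : ℂ))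
    (hp : ∀ z ∈ {z : ℂ | 0 < z.im}, 0 ≤ (F z).im) : MatrixMonotoneOn g (-1) 1 := by
  set φ : ℂ → ℂ := fun w => F (2 * w / (1 + w ^ 2)) with hφ
  have hJpos : ∀ w ∈ ball (0 : ℂ) 1, 0 < w.im → 0 < (2 * w / (1 + w ^ 2)).im := by
    intro w hw hw0
    rw [mem_ball_zero_iff] at hw
    obtain ⟨h1, h2⟩ := im_joukowski_pos hw
    rw [h2]
    have := normSq_pos.2 h1
    have : 0 < 1 - ‖w‖ ^ 2 := by nlinarith [norm_nonneg w]
    positivity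
  have hJreal : ∀ w ∈ ball (0 : ℂ) 1, w.im = 0 →
      ∃ x ∈ Ioo (-1 : ℝ) 1, (x : ℂ) = 2 * w / (1 + w ^ 2) := by
    intro w hw hw0
    rw [mem_ball_zero_iff] at hw
    obtain ⟨t, rfl⟩ : ∃ t : ℝ, (t : ℂ) = w := ⟨w.re, Complex.ext (by simp) (by simp [hw0])⟩
    rw [norm_real, Real.norm_eq_abs, abs_lt] at hw
    refine ⟨2 * t / (1 + t ^ 2), ⟨?_, ?_⟩, by push_cast; rfl⟩
    · rw [lt_div_iff₀ (by positivity)]; nlinarith [hw.1, hw.2]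
    · rw [div_lt_iff₀ (by positivity)]; nlinarith [hw.1, hw.2]
  have hJcont : ContinuousOn (fun w : ℂ => 2 * w / (1 + w ^ 2)) (ball 0 1) :=
    ContinuousOn.div (by fun_prop) (by fun_prop) fun w hw =>
      (im_joukowski_pos (mem_ball_zero_iff.1 hw)).1
  have hG : DifferentiableOn ℂ (schwarzReflection φ) (ball 0 1) := by
    refine differentiableOn_schwarzReflection ?_ ?_ ?_
    · refine hc.comp (hJcont.mono inter_subset_left) ?_
      rintro w ⟨hw, hw0⟩
      rcases (show 0 ≤ w.im from hw0).eq_or_lt with h | h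
      · obtain ⟨x, hx, e⟩ := hJreal w hw h.symm
        exact Or.inr ⟨x, hx, e⟩
      · exact Or.inl (hJpos w hw h)
    · intro w hw hw0
      refine DifferentiableAt.comp w (hd.differentiableAt
        ((isOpen_lt continuous_const continuous_im).mem_nhds (hJpos w hw hw0))) ?_
      exact DifferentiableAt.div (by fun_prop) (by fun_prop)
        (im_joukowski_pos (mem_ball_zero_iff.1 hw)).1
    · intro w hw hw0
      obtain ⟨x, hx, e⟩ := hJreal w hw hw0
      simp only [hφ]
      rw [← e, hr x hx, ofReal_im]
  have hφ0 : ∀ w ∈ ball (0 : ℂ) 1, 0 ≤ w.im → 0 ≤ (φ w).im := by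
    intro w hw hw0
    rcases hw0.eq_or_lt with h | h
    · obtain ⟨x, hx, e⟩ := hJreal w hw h.symm
      simp only [hφ]
      rw [← e, hr x hx, ofReal_im]
    · exact hp _ (hJpos w hw h)
  have hGs : ∀ z ∈ ball (0 : ℂ) 1, 0 ≤ z.im * (schwarzReflection φ z).im := by
    intro z hz
    rw [schwarzReflection]
    split_ifs with h
    · exact mul_nonneg h (hφ0 z hz h)
    · have := hφ0 (conj z) (by simpa using hz) (by rw [conj_im]; linarith)
      rw [conj_im]
      nlinarith
  have hmono : ∀ᶠ r : ℝ in 𝓝[<] 1, MatrixMonotoneOn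
      (fun x => (schwarzReflection φ (r * ((x / (1 + √(1 - x ^ 2)) : ℝ) : ℂ))).re) (-1) 1 := by
    filter_upwards [Ioo_mem_nhdsLT (show (0 : ℝ) < 1 by norm_num)] with r hr
    have hmaps : ∀ z ∈ ball (0 : ℂ) r⁻¹, (r : ℂ) * z ∈ ball (0 : ℂ) 1 := by
      intro z hz
      rw [mem_ball_zero_iff] at hz ⊢
      rw [norm_mul, norm_real, Real.norm_eq_abs, abs_of_pos hr.1]
      calc r * ‖z‖ < r * r⁻¹ := mul_lt_mul_of_pos_left hz hr.1
        _ = 1 := mul_inv_cancel₀ hr.1.ne'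
    refine matrixMonotoneOn_of_typicallyReal (H := fun z => schwarzReflection φ (r * z))
      ((one_lt_inv₀ hr.1).2 hr.2) (hG.comp (by fun_prop) hmaps) fun z hz => ?_
    have := hGs _ (hmaps z hz)
    rw [im_ofReal_mul, mul_assoc] at this
    exact nonneg_of_mul_nonneg_right this hr.1
  refine MatrixMonotoneOn.of_tendsto hmono fun x hx => ?_
  obtain ⟨hw, hxw⟩ := joukowski_inverse hx
  set w := x / (1 + √(1 - x ^ 2))
  have hwb : (w : ℂ) ∈ ball (0 : ℂ) 1 := by simpa using hw
  have e : schwarzReflection φ w = g x := by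
    rw [schwarzReflection, if_pos (by simp), hφ, ← hr x hx]
    rw [hxw]; push_cast; rfl
  have hcont : ContinuousAt (schwarzReflection φ) ((1 : ℝ) * w) := by
    rw [ofReal_one, one_mul]
    exact (hG.differentiableAt (isOpen_ball.mem_nhds hwb)).continuousAt
  have : Tendsto (fun r : ℝ => (schwarzReflection φ (r * w)).re) (𝓝 1)
      (𝓝 (schwarzReflection φ ((1 : ℝ) * w)).re) :=
    (continuous_re.continuousAt.comp hcont).tendsto.comp
      (f := fun r : ℝ => (r : ℂ) * w) (by
        have : Continuous fun r : ℝ => (r : ℂ) * w := by fun_prop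
        exact this.tendsto 1)
  rw [ofReal_one, one_mul, e, ofReal_re] at this
  exact this.mono_left nhdsWithin_le_nhds

end

section

open Complex Metric Set Filter Topology ComplexConjugate

/-- A Pick function on the upper half plane with continuous real boundary values on `(a, b)` is
matrix monotone there. -/
lemma matrixMonotoneOn_of_pick_Ioo {a b : ℝ} (hab : a < b) {f : ℝ → ℝ} {F : ℂ → ℂ}
    (hc : ContinuousOn F ({z : ℂ | 0 < z.im} ∪ (Complex.ofReal '' Ioo a b)))
    (hd : DifferentiableOn ℂ F {z : ℂ | 0 < z.im})
    (hr : ∀ x ∈ Ioo a b, F (x : ℂ) = (f x : ℂ))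
    (hp : ∀ z ∈ {z : ℂ | 0 < z.im}, 0 ≤ (F z).im) : MatrixMonotoneOn f a b := by
  obtain ⟨m, hm⟩ : ∃ m, m = (a + b) / 2 := ⟨_, rfl⟩
  obtain ⟨r, hr'⟩ : ∃ r, r = (b - a) / 2 := ⟨_, rfl⟩
  have hr0 : 0 < r := by linarith
  have hmap : ∀ x ∈ Ioo (-1 : ℝ) 1, r * x + m ∈ Ioo a b := fun x hx =>
    ⟨by nlinarith [hx.1], by nlinarith [hx.2]⟩
  have hup : MapsTo (fun z : ℂ => r * z + m) {z : ℂ | 0 < z.im} {z : ℂ | 0 < z.im} := by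
    intro z (hz : 0 < z.im)
    simpa using mul_pos hr0 hz
  have key : MatrixMonotoneOn (fun x => f (r * x + m)) (-1) 1 := by
    refine matrixMonotoneOn_of_pick (F := fun z => F (r * z + m)) ?_ ?_ ?_ ?_
    · refine hc.comp (f := fun z : ℂ => r * z + m) (by fun_prop) ?_
      rintro z (hz | ⟨x, hx, rfl⟩)
      · exact Or.inl (hup hz)
      · exact Or.inr ⟨_, hmap x hx, by push_cast; rfl⟩
    · exact hd.comp (f := fun z : ℂ => r * z + m) (by fun_prop) hup
    · intro x hx
      rw [← hr _ (hmap x hx)]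
      push_cast; rfl
    · exact fun z hz => hp _ (hup hz)
  refine (key.comp_affine (a' := a) (b' := b) (r := r⁻¹) (m := -(r⁻¹ * m)) (by positivity)
    fun x hx => ?_).congr fun x _ => ?_
  · rw [← sub_eq_add_neg, ← mul_sub, inv_mul_eq_div]
    exact ⟨by rw [lt_div_iff₀ hr0]; linarith [hx.1], by rw [div_lt_iff₀ hr0]; linarith [hx.2]⟩
  · congr 1
    field_simp
    ring

end

section

open Filter Topology
open scoped Matrix.Norms.L2Operator

lemma Matrix.IsHermitian.finite_spectrum_real {n : ℕ} {B : Matrix (Fin n) (Fin n) ℂ}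
    (hB : B.IsHermitian) : (spectrum ℝ B).Finite := by
  rw [hB.spectrum_real_eq_range_eigenvalues]; exact Set.finite_range _

lemma cfc_eq_algebraMap_add {n : ℕ} {B : Matrix (Fin n) (Fin n) ℂ} (hB : B.IsHermitian)
    {g h : ℝ → ℝ} {x c : ℝ} (H : ∀ y, g y = c + (y - x) * h y) :
    cfc g B = algebraMap ℝ _ c + (B - algebraMap ℝ _ x) * cfc h B := by
  have hB' : IsSelfAdjoint B := hB
  have hf := hB.finite_spectrum_real
  obtain rfl : g = fun y => c + (y - x) * h y := funext H
  rw [cfc_const_add c _ B (hf.continuousOn _) hB', cfc_mul _ _ B (by fun_prop) (hf.continuousOn _),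
    cfc_sub _ _ B (by fun_prop) (by fun_prop), cfc_id' ℝ B, cfc_const x B hB']

lemma cfc_diagonal_apply {n : ℕ} (x : Fin n → ℝ) (g : ℝ → ℝ) (i j : Fin n) :
    cfc g (diagonal fun i => (x i : ℂ)) i j = if i = j then (g (x i) : ℂ) else 0 := by
  have hA : (diagonal fun i => (x i : ℂ)).IsHermitian := by
    rw [isHermitian_diagonal_iff]; intro i; simp [IsSelfAdjoint]
  rw [cfc_eq_algebraMap_add hA (h := slope g (x i)) (x := x i) (c := g (x i)),
    Matrix.add_apply, mul_apply]
  · simp [algebraMap_eq_diagonal, diagonal_apply]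
  · intro y
    have := sub_smul_slope g (x i) y
    simp only [smul_eq_mul, vsub_eq_sub] at this
    linarith

/-- The matrix of all ones. -/
lemma posSemidef_ones (n : ℕ) : (of fun _ _ => 1 : Matrix (Fin n) (Fin n) ℂ).PosSemidef := by
  have := posSemidef_vecMulVec_self_star (R := ℂ) (fun _ : Fin n => (1 : ℂ))
  convert this using 1
  ext i j
  simp [vecMulVec]

/-- Loewner's theorem on the positivity of the matrix of divided differences. -/
lemma MatrixMonotoneOn.posSemidef_dslope {a b : ℝ} {f : ℝ → ℝ} (hf : MatrixMonotoneOn f a b)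
    (hd : Differentiable ℝ f) {n : ℕ} (x : Fin n → ℝ) (hx : ∀ i, x i ∈ Set.Ioo a b) :
    (of fun i j => dslope f (x i) (x j)).PosSemidef := by
  have hgc : ∀ i, Continuous (dslope f (x i)) := fun i => by
    rw [continuous_iff_continuousAt]
    intro y
    rcases eq_or_ne y (x i) with rfl | h
    · exact continuousAt_dslope_same.2 (hd _)
    · exact (continuousAt_dslope_of_ne h).2 hd.continuous.continuousAt
  set A : Matrix (Fin n) (Fin n) ℂ := diagonal fun i => (x i : ℂ) with hA'
  set C : Matrix (Fin n) (Fin n) ℂ := of fun _ _ => 1 with hC'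
  have hA : A.IsHermitian := by
    rw [hA', isHermitian_diagonal_iff]; intro i; simp [IsSelfAdjoint]
  have hC : C.PosSemidef := posSemidef_ones n
  have hB : ∀ t : ℝ, (A + t • C).IsHermitian := fun t => by
    refine hA.add ?_
    rw [IsHermitian, conjTranspose_smul, hC.1.eq, star_trivial]
  have hBt : Tendsto (fun t : ℝ => A + t • C) (𝓝[>] 0) (𝓝 A) := by
    have : Continuous fun t : ℝ => A + t • C := by fun_prop
    have := this.tendsto 0
    rw [zero_smul, add_zero] at this
    exact this.mono_left nhdsWithin_le_nhds
  have sA : spectrum ℝ A ⊆ Set.Ioo a b := by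
    rw [← spectrum.preimage_algebraMap (R := ℝ) ℂ, hA', spectrum_diagonal]
    rintro y ⟨i, hi⟩
    have : x i = y := Complex.ofReal_injective hi
    exact this ▸ hx i
  have sB : ∀ᶠ t : ℝ in 𝓝[>] 0, spectrum ℝ (A + t • C) ⊆ Set.Ioo a b :=
    hBt.eventually ((upperHemicontinuous_iff_forall_isOpen.1
      (upperHemicontinuous_spectrum ℝ (Matrix (Fin n) (Fin n) ℂ)) A _ isOpen_Ioo sA))
  have hentry : ∀ (t : ℝ) (i j : Fin n), (cfc f (A + t • C) - cfc f A) i j =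
      t * ∑ k, cfc (dslope f (x i)) (A + t • C) k j := by
    intro t i j
    have h1 : cfc f (A + t • C) = algebraMap ℝ _ (f (x i)) +
        (A + t • C - algebraMap ℝ _ (x i)) * cfc (dslope f (x i)) (A + t • C) :=
      cfc_eq_algebraMap_add (hB t) fun y => by
        have := sub_smul_dslope f (x i) y
        simp only [smul_eq_mul] at this
        linarith
    rw [Matrix.sub_apply, cfc_diagonal_apply, h1, Matrix.add_apply, mul_apply, Finset.mul_sum]
    have h2 : ∀ k, (A + t • C - algebraMap ℝ _ (x i)) i k = t := by
      intro k
      simp [hA', hC', algebraMap_eq_diagonal, diagonal_apply]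
    simp only [h2]
    simp [algebraMap_eq_diagonal, diagonal_apply]
  have hlim : ∀ i k j, Tendsto (fun t : ℝ => cfc (dslope f (x i)) (A + t • C) k j) (𝓝[>] 0)
      (𝓝 (cfc (dslope f (x i)) A k j)) := fun i k j => by
    have := hBt.cfc isCompact_Icc (dslope f (x i))
      (sB.mono fun t ht => ht.trans Set.Ioo_subset_Icc_self)
      (Eventually.of_forall hB) (sA.trans Set.Ioo_subset_Icc_self) hA (hgc i).continuousOn
    exact ((continuous_id.matrix_elem k j).tendsto _).comp this
  rw [posSemidef_iff_dotProduct_mulVec]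
  refine ⟨?_, fun v => ?_⟩
  · ext i j
    rcases eq_or_ne i j with rfl | hij
    · simp
    · rcases eq_or_ne (x i) (x j) with h | h
      · simp [h]
      · simp [dslope_of_ne _ h, dslope_of_ne _ h.symm, slope_comm]
  have key : Tendsto (fun t : ℝ => ∑ i, ∑ j, v i *
      (∑ k, cfc (dslope f (x i)) (A + t • C) k j).re * v j) (𝓝[>] 0)
      (𝓝 (∑ i, ∑ j, v i * dslope f (x i) (x j) * v j)) := by
    refine tendsto_finsetSum _ fun i _ => tendsto_finsetSum _ fun j _ =>
      (Tendsto.const_mul _ ?_).mul_const _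
    have h1 := tendsto_finsetSum Finset.univ fun k _ => hlim i k j
    have h2 := (Complex.continuous_re.tendsto _).comp h1
    simpa [hA', cfc_diagonal_apply, Function.comp_def] using h2
  have e : star v ⬝ᵥ ((of fun i j => dslope f (x i) (x j)) *ᵥ v) =
      ∑ i, ∑ j, v i * dslope f (x i) (x j) * v j := by
    simp [dotProduct, mulVec, Finset.mul_sum, mul_assoc]
  rw [e]
  refine ge_of_tendsto key ?_
  filter_upwards [sB, self_mem_nhdsWithin] with t ht ht0
  have ht0 : 0 < t := ht0
  have hpsd := matrixMonotoneOn_iff_cfc.1 hf n A (A + t • C) hA (hB t) sA ht (by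
    rw [add_sub_cancel_left]
    exact hC.smul ht0.le)
  have h3 := (Complex.nonneg_iff.1 ((posSemidef_iff_dotProduct_mulVec.1 hpsd).2
    fun i => (v i : ℂ))).1
  refine nonneg_of_mul_nonneg_right (a := t) (h3.trans_eq ?_) ht0
  obtain ⟨S, hS'⟩ : ∃ S : Fin n → Fin n → ℂ,
      S = fun i j => ∑ k, cfc (dslope f (x i)) (A + t • C) k j := ⟨_, rfl⟩
  have hS : ∀ i j, (cfc f (A + t • C) - cfc f A) i j = t * S i j := fun i j => by
    rw [hS', hentry]
  simp only [← congrFun (congrFun hS' _) _]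
  change _ = t * ∑ i, ∑ j, v i * (S i j).re * v j
  simp only [dotProduct, mulVec, hS, Finset.mul_sum, Complex.re_sum]
  refine Finset.sum_congr rfl fun i _ => Finset.sum_congr rfl fun j _ => ?_
  simp
  ring

end

section

open scoped MatrixOrder

/-- Simultaneous diagonalisation of a positive definite and a symmetric real matrix. -/
lemma Matrix.PosDef.exists_simultaneous_diagonalization {ι : Type*} [Fintype ι] [DecidableEq ι]
    {L S : Matrix ι ι ℝ} (hL : L.PosDef) (hS : S.IsHermitian) :
    ∃ (E : (Matrix ι ι ℝ)ˣ) (c : ι → ℝ), L = (E : Matrix ι ι ℝ)ᵀ * E ∧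
      S = (E : Matrix ι ι ℝ)ᵀ * diagonal c * E := by
  obtain ⟨y, hy, hLy⟩ := CStarAlgebra.isStrictlyPositive_iff_eq_star_mul_self.mp
    hL.isStrictlyPositive
  lift y to (Matrix ι ι ℝ)ˣ using hy
  rw [star_eq_conjTranspose, conjTranspose_eq_transpose_of_trivial] at hLy
  set W : Matrix ι ι ℝ := ↑y⁻¹
  have hM : (Wᵀ * S * W).IsHermitian := by
    have hS' : Sᵀ = S := by rw [← conjTranspose_eq_transpose_of_trivial]; exact hS
    rw [IsHermitian, conjTranspose_eq_transpose_of_trivial]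
    simp only [transpose_mul, transpose_transpose, hS', Matrix.mul_assoc]
  have hV := hM.spectral_theorem
  rw [Unitary.conjStarAlgAut_apply] at hV
  have hc : ∀ N : Matrix ι ι ℝ, (star N)ᵀ = N := fun N => by
    rw [star_eq_conjTranspose, conjTranspose_eq_transpose_of_trivial, transpose_transpose]
  have hVV := Unitary.mul_star_self hM.eigenvectorUnitary
  have hVV' : (hM.eigenvectorUnitary : Matrix ι ι ℝ) * star (hM.eigenvectorUnitary : Matrix ι ι ℝ)
      = 1 := congrArg Subtype.val hVV
  have hE : ((star (Unitary.toUnits hM.eigenvectorUnitary) * y : (Matrix ι ι ℝ)ˣ) : Matrix ι ι ℝ) =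
      star (hM.eigenvectorUnitary : Matrix ι ι ℝ) * y := rfl
  have hyW : W * y = 1 := y.inv_mul
  have hWy : (y : Matrix ι ι ℝ)ᵀ * Wᵀ = 1 := by rw [← transpose_mul, hyW, transpose_one]
  refine ⟨star (Unitary.toUnits hM.eigenvectorUnitary) * y, hM.eigenvalues, ?_, ?_⟩
  · rw [hE, transpose_mul, hc, Matrix.mul_assoc, ← Matrix.mul_assoc _ _ (y : Matrix ι ι ℝ), hVV',
      Matrix.one_mul, hLy]
  · have : S = (y : Matrix ι ι ℝ)ᵀ * (Wᵀ * S * W) * y := by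
      rw [Matrix.mul_assoc, Matrix.mul_assoc, hyW, Matrix.mul_one, ← Matrix.mul_assoc, hWy,
        Matrix.one_mul]
    rw [hE, transpose_mul, hc]
    conv_lhs => rw [this, hV]
    simp only [Matrix.mul_assoc]
    rfl

/-- Interpolation of a function with positive definite Loewner matrix at points `t i` by a finite
combination of the functions `x ↦ x / (1 - c x)`. -/
lemma Matrix.PosDef.exists_loewner_interpolation {ι : Type*} [Fintype ι] [DecidableEq ι]
    {L : Matrix ι ι ℝ} (hL : L.PosDef) {t F : ι → ℝ} (ht : Function.Injective t) {o : ι}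
    (ho : t o = 0) (hF : F o = 0)
    (hLF : ∀ i j, i ≠ j → L i j = (F i - F j) / (t i - t j)) :
    ∃ (E : ι → ι → ℝ) (c : ι → ℝ), (∀ i k, (1 - t i * c k) * E k i = E k o) ∧
      ∀ i j, ∑ k, E k i * E k j = L i j := by
  have ht0 : ∀ i, i ≠ o → t i ≠ 0 := fun i hi h => hi (ht (h.trans ho.symm))
  have hLs : ∀ i j, L i j = L j i := fun i j => by
    simpa using (hL.1.apply j i)
  have hLo : ∀ i, i ≠ o → L i o = F i / t i := fun i hi => by
    rw [hLF i o hi, hF, ho, sub_zero, sub_zero]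
  set S : Matrix ι ι ℝ := of fun i j =>
    if i = o then (if j = o then 0 else (L j o - L o o) / t j) else (L i j - L o j) / t i with hS
  have hSh : S.IsHermitian := by
    ext i j
    simp only [hS, conjTranspose_apply, of_apply, star_trivial]
    rcases eq_or_ne i o with hi | hi <;> rcases eq_or_ne j o with hj | hj
    · simp [hi, hj]
    · simp [hi, hj]
    · simp [hi, hj]
    · simp only [if_neg hi, if_neg hj]
      rcases eq_or_ne i j with rfl | hij
      · rfl
      · rw [hLF j i hij.symm, hLF i j hij, hLs o i, hLs o j, hLo i hi,
          hLo j hj]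
        have h1 := ht0 i hi
        have h2 := ht0 j hj
        have h3 : t i - t j ≠ 0 := sub_ne_zero.2 (ht.ne hij)
        have h4 : t j - t i ≠ 0 := sub_ne_zero.2 (ht.ne hij.symm)
        field_simp
        ring
  have hSe : ∀ i j, t i * S i j = L i j - L o j := by
    intro i j
    rcases eq_or_ne i o with rfl | hi
    · simp [ho]
    · simp only [hS, of_apply, if_neg hi]
      rw [mul_div_cancel₀ _ (ht0 i hi)]
  obtain ⟨E, c, h1, h2⟩ := hL.exists_simultaneous_diagonalization hSh
  refine ⟨fun k i => (E : Matrix ι ι ℝ) k i, c, fun i => ?_, fun i j => ?_⟩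
  · have h3 : ∀ j, ∑ k, ((1 - t i * c k) * (E : Matrix ι ι ℝ) k i - (E : Matrix ι ι ℝ) k o) *
        (E : Matrix ι ι ℝ) k j = 0 := by
      intro j
      have := hSe i j
      rw [h1, h2] at this
      simp only [mul_apply, transpose_apply, diagonal_apply, mul_ite, mul_zero,
        Finset.sum_ite_eq', Finset.mem_univ, if_true] at this
      rw [← sub_eq_zero, Finset.mul_sum, ← Finset.sum_sub_distrib, ← Finset.sum_sub_distrib] at this
      rw [← neg_eq_zero, ← Finset.sum_neg_distrib, ← this]
      refine Finset.sum_congr rfl fun k _ => ?_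
      ring
    have h4 : (fun k => (1 - t i * c k) * (E : Matrix ι ι ℝ) k i - (E : Matrix ι ι ℝ) k o) ᵥ*
        (E : Matrix ι ι ℝ) = 0 := funext h3
    have h5 := congrArg (· ᵥ* ((E⁻¹ : (Matrix ι ι ℝ)ˣ) : Matrix ι ι ℝ)) h4
    simp only [vecMul_vecMul, Units.mul_inv, vecMul_one, zero_vecMul] at h5
    exact fun k => sub_eq_zero.1 (congrFun h5 k)
  · conv_rhs => rw [h1, mul_apply]
    rfl

end

lemma exists_natFloor_near {M : ℕ} {s : ℝ} (hs : |s| < 1) :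
    ∃ j : Fin (2 * M + 1), |s - ((j : ℝ) - M) / (M + 1)| ≤ 1 / (M + 1) := by
  obtain ⟨h1, h2⟩ := abs_lt.1 hs
  have hM : (0 : ℝ) < M + 1 := by positivity
  have e1 : (M + 1) * s < M + 1 := by nlinarith
  have e2 : -(M + 1 : ℝ) < (M + 1) * s := by nlinarith
  have key : ∃ j : Fin (2 * M + 1), |(M + 1) * s + M - j| ≤ 1 := by
    rcases le_or_gt 0 ((M + 1) * s + M) with h | h
    · refine ⟨⟨⌊(M + 1) * s + M⌋₊, (Nat.floor_lt h).2 (by push_cast; linarith)⟩, ?_⟩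
      rw [abs_le]
      have h3 := Nat.floor_le h
      have h4 := Nat.lt_floor_add_one ((M + 1) * s + M)
      constructor <;> dsimp only <;> linarith
    · refine ⟨⟨0, by positivity⟩, ?_⟩
      rw [abs_le]
      constructor <;> simp only [Nat.cast_zero] <;> linarith
  obtain ⟨j, hj⟩ := key
  refine ⟨j, ?_⟩
  have : s - ((j : ℝ) - M) / (M + 1) = ((M + 1) * s + M - j) / (M + 1) := by
    field_simp
    ring
  rw [this, abs_div, abs_of_pos hM]
  gcongr

/-- A smooth matrix monotone function on `(-1, 1)` agrees on a grid, up to a small error, with a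
positive combination of the functions `x ↦ x / (1 - c x)`, `|c| ≤ 1`. -/
lemma MatrixMonotoneOn.exists_approx {f : ℝ → ℝ} (hf : MatrixMonotoneOn f (-1) 1)
    (hd : Differentiable ℝ f) (h0 : f 0 = 0) {B : ℝ} (hB : ∀ x ∈ Set.Ioo (-1 : ℝ) 1, deriv f x ≤ B)
    (M : ℕ) : ∃ c w : Fin (2 * M + 1) → ℝ, (∀ k, |c k| ≤ 1) ∧ (∀ k, 0 ≤ w k) ∧
      ∑ k, w k ≤ B + 1 ∧ ∀ (i : Fin (2 * M + 1)) (x : ℝ), x = ((i : ℝ) - M) / (M + 1) →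
        |f x - ∑ k, w k * (x / (1 - c k * x))| ≤ (B + 1) * √(8 / (M + 1)) := by
  have hM : (0 : ℝ) < M + 1 := by positivity
  set t : Fin (2 * M + 1) → ℝ := fun i => ((i : ℝ) - M) / (M + 1) with ht
  have htm : ∀ i, t i ∈ Set.Ioo (-1 : ℝ) 1 := fun i => by
    have : (i : ℝ) < 2 * M + 1 := by exact_mod_cast i.2
    constructor
    · rw [ht, lt_div_iff₀ hM]
      have : (0 : ℝ) ≤ i := by positivity
      linarith
    · rw [ht, div_lt_one hM]
      linarith
  have hti : Function.Injective t := fun i j h => by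
    rw [ht] at h
    simp only at h
    rw [div_left_inj' hM.ne', sub_left_inj] at h
    exact Fin.ext (by exact_mod_cast h)
  obtain ⟨o, ho⟩ : ∃ o, t o = 0 := ⟨⟨M, by omega⟩, by simp [ht]⟩
  set L : Matrix (Fin (2 * M + 1)) (Fin (2 * M + 1)) ℝ :=
    (of fun i j => dslope f (t i) (t j)) + 1 with hL
  have hLpos : L.PosDef := PosDef.posSemidef_add (hf.posSemidef_dslope hd t htm) PosDef.one
  have hLd : ∀ i, L i i ≤ B + 1 := fun i => by
    simpa [hL] using hB _ (htm i)
  have hLoff : ∀ i j, i ≠ j → L i j = (f (t i) - f (t j)) / (t i - t j) := fun i j hij => by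
    have : t j ≠ t i := hti.ne hij.symm
    simp only [hL, Matrix.add_apply, of_apply, one_apply_ne hij, add_zero]
    rw [dslope_of_ne f this, slope_comm, slope_def_field]
  obtain ⟨E, c, hE, hEL⟩ := hLpos.exists_loewner_interpolation hti ho (F := fun i => f (t i))
    (by simp only [ho, h0]) hLoff
  have hsq : ∀ i, ∑ k, E k i ^ 2 ≤ B + 1 := fun i => by
    simp only [pow_two]
    exact (hEL i i).trans_le (hLd i)
  have hB0 : 0 ≤ B + 1 := (Finset.sum_nonneg fun k _ => sq_nonneg _).trans (hsq o)
  have hbad : ∑ k with ¬ |c k| ≤ 1, (E k o / c k) ^ 2 ≤ 2 * (B + 1) / (M + 1) := by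
    calc ∑ k with ¬ |c k| ≤ 1, (E k o / c k) ^ 2
        ≤ ∑ k with ¬ |c k| ≤ 1, ∑ j, (1 / (M + 1)) ^ 2 * E k j ^ 2 := by
          refine Finset.sum_le_sum fun k hk => ?_
          have hk : 1 < |c k| := by simpa using hk
          have hc0 : c k ≠ 0 := fun h => by rw [h, abs_zero] at hk; linarith
          obtain ⟨j, hj⟩ := exists_natFloor_near (M := M) (s := (c k)⁻¹) (by
            rw [abs_inv]; exact inv_lt_one_of_one_lt₀ hk)
          have : E k o / c k = ((c k)⁻¹ - t j) * E k j := by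
            rw [← hE j k]
            field_simp
          calc (E k o / c k) ^ 2 = ((c k)⁻¹ - t j) ^ 2 * E k j ^ 2 := by rw [this, mul_pow]
            _ ≤ (1 / (M + 1)) ^ 2 * E k j ^ 2 := by
              gcongr ?_ * _
              rw [← sq_abs]
              gcongr
            _ ≤ _ := Finset.single_le_sum (f := fun j => (1 / (M + 1 : ℝ)) ^ 2 * E k j ^ 2)
              (fun j _ => by positivity) (Finset.mem_univ j)
      _ ≤ ∑ k, ∑ j, (1 / (M + 1)) ^ 2 * E k j ^ 2 :=
          Finset.sum_le_sum_of_subset_of_nonneg (Finset.filter_subset _ _)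
            fun k _ _ => Finset.sum_nonneg fun j _ => by positivity
      _ = ∑ j, (1 / (M + 1)) ^ 2 * ∑ k, E k j ^ 2 := by
          rw [Finset.sum_comm]
          simp only [Finset.mul_sum]
      _ ≤ ∑ j : Fin (2 * M + 1), (1 / (M + 1 : ℝ)) ^ 2 * (B + 1) := by
          gcongr with j
          exact hsq j
      _ = (2 * M + 1) * ((1 / (M + 1 : ℝ)) ^ 2 * (B + 1)) := by simp
      _ ≤ (2 * (M + 1)) * ((1 / (M + 1 : ℝ)) ^ 2 * (B + 1)) := by
          gcongr
          linarith
      _ = _ := by field_simp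
  refine ⟨fun k => if |c k| ≤ 1 then c k else 0, fun k => if |c k| ≤ 1 then E k o ^ 2 else 0,
    fun k => ?_, fun k => ?_, ?_, ?_⟩
  · dsimp only
    split_ifs with h
    · exact h
    · simp
  · dsimp only
    split_ifs with h <;> positivity
  · refine (Finset.sum_le_sum fun k _ => ?_).trans (hsq o)
    split_ifs with h
    · exact le_rfl
    · positivity
  rintro i x rfl
  change |f (t i) - _| ≤ _
  have e1 : f (t i) = ∑ k, t i * (E k i * E k o) := by
    rw [← Finset.mul_sum, hEL]
    rcases eq_or_ne i o with rfl | hi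
    · rw [ho, zero_mul, h0]
    · have : t i ≠ 0 := fun h => hi (hti (h.trans ho.symm))
      rw [hLoff i o hi, ho, h0, sub_zero, sub_zero, mul_div_cancel₀ _ this]
  have e2 : f (t i) - ∑ k, (if |c k| ≤ 1 then E k o ^ 2 else 0) *
      (t i / (1 - (if |c k| ≤ 1 then c k else 0) * t i)) =
      ∑ k with ¬ |c k| ≤ 1, (E k i - E k o) * (E k o / c k) := by
    rw [e1, ← Finset.sum_sub_distrib, Finset.sum_filter]
    refine Finset.sum_congr rfl fun k _ => ?_
    by_cases h : |c k| ≤ 1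
    · simp only [h, if_true, not_true, if_false]
      have hne : 1 - c k * t i ≠ 0 := by
        have := abs_lt.2 (htm i)
        have h3 : |c k * t i| < 1 := by
          rw [abs_mul]
          nlinarith [abs_nonneg (c k), abs_nonneg (t i)]
        linarith [(abs_lt.1 h3).2]
      have h4 := hE i k
      rw [← h4]
      field_simp
      ring
    · simp only [h, if_false, not_false_iff, if_true, zero_mul, sub_zero]
      have hc0 : c k ≠ 0 := fun h' => h (by simp [h'])
      rw [← hE i k]
      field_simp
      ring
  change |f (t i) - ∑ k, (if |c k| ≤ 1 then E k o ^ 2 else 0) *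
      (t i / (1 - (if |c k| ≤ 1 then c k else 0) * t i))| ≤ _
  rw [e2]
  have e3 : ∑ k with ¬ |c k| ≤ 1, (E k i - E k o) ^ 2 ≤ 4 * (B + 1) := by
    calc ∑ k with ¬ |c k| ≤ 1, (E k i - E k o) ^ 2 ≤ ∑ k, (E k i - E k o) ^ 2 :=
          Finset.sum_le_sum_of_subset_of_nonneg (Finset.filter_subset _ _)
            fun k _ _ => by positivity
      _ ≤ ∑ k, (2 * E k i ^ 2 + 2 * E k o ^ 2) :=
          Finset.sum_le_sum fun k _ => by nlinarith [sq_nonneg (E k i + E k o)]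
      _ ≤ _ := by
          rw [Finset.sum_add_distrib, ← Finset.mul_sum, ← Finset.mul_sum]
          linarith [hsq i, hsq o]
  refine abs_le_of_sq_le_sq ?_ (by positivity)
  calc _ ≤ (∑ k with ¬ |c k| ≤ 1, (E k i - E k o) ^ 2) * ∑ k with ¬ |c k| ≤ 1, (E k o / c k) ^ 2 :=
        Finset.sum_mul_sq_le_sq_mul_sq _ _ _
    _ ≤ (4 * (B + 1)) * (2 * (B + 1) / (M + 1)) := by
        gcongr
    _ = _ := by
        rw [mul_pow, Real.sq_sqrt (by positivity)]
        field_simp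
        ring

section

open MeasureTheory Set Filter Topology Metric

/-- The Pick function `z ↦ ∫ z / (1 - c z) dμ(c)` of a measure `μ` on `[-1, 1]`. -/
noncomputable def pickTransform (μ : Measure (Icc (-1 : ℝ) 1)) (z : ℂ) : ℂ :=
  ∫ c : Icc (-1 : ℝ) 1, z / (1 - (c : ℝ) * z) ∂μ

lemma one_sub_mul_ne_zero {z : ℂ} (hz : z ∈ {z : ℂ | 0 < z.im} ∪ ball 0 1)
    (c : Icc (-1 : ℝ) 1) : 1 - ((c : ℝ) : ℂ) * z ≠ 0 := by
  intro h
  rcases hz with hz | hz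
  · have hz : 0 < z.im := hz
    have h1 := congrArg Complex.im h
    have h2 : (c : ℝ) = 0 := by simpa [hz.ne'] using h1
    simp [h2] at h
  · rw [mem_ball_zero_iff] at hz
    have h1 : ‖((c : ℝ) : ℂ) * z‖ = 1 := by rw [← sub_eq_zero.1 h, norm_one]
    rw [norm_mul, Complex.norm_real, Real.norm_eq_abs] at h1
    have h2 : |(c : ℝ)| ≤ 1 := abs_le.2 c.2
    nlinarith [norm_nonneg z]

lemma isOpen_upperHalfPlane_union_ball : IsOpen ({z : ℂ | 0 < z.im} ∪ ball 0 1) :=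
  (isOpen_lt continuous_const Complex.continuous_im).union isOpen_ball

lemma continuous_div_one_sub_mul {z : ℂ} (hz : z ∈ {z : ℂ | 0 < z.im} ∪ ball 0 1) :
    Continuous fun c : Icc (-1 : ℝ) 1 => z / (1 - (c : ℝ) * z) :=
  continuous_const.div (by fun_prop) (one_sub_mul_ne_zero hz)

lemma Continuous.integrable_of_compactSpace {X E : Type*} [TopologicalSpace X] [CompactSpace X]
    [MeasurableSpace X] [OpensMeasurableSpace X] [NormedAddCommGroup E]
    {μ : Measure X} [IsFiniteMeasure μ] {g : X → E} (hg : Continuous g) : Integrable g μ :=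
  hg.integrable_of_hasCompactSupport (HasCompactSupport.of_compactSpace g)

lemma differentiableOn_pickTransform (μ : Measure (Icc (-1 : ℝ) 1)) [IsFiniteMeasure μ] :
    DifferentiableOn ℂ (pickTransform μ) ({z : ℂ | 0 < z.im} ∪ ball 0 1) := by
  intro z₀ hz₀
  obtain ⟨r, hr, hrU⟩ := nhds_basis_closedBall.mem_iff.1
    (isOpen_upperHalfPlane_union_ball.mem_nhds hz₀)
  have hcont : ContinuousOn (fun p : Icc (-1 : ℝ) 1 × ℂ => ((1 - ((p.1 : ℝ) : ℂ) * p.2) ^ 2)⁻¹)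
      (univ ×ˢ closedBall z₀ r) :=
    ContinuousOn.inv₀ (by fun_prop) fun p hp => pow_ne_zero 2 (one_sub_mul_ne_zero (hrU hp.2) _)
  obtain ⟨C, hC⟩ := (isCompact_univ.prod (isCompact_closedBall z₀ r)).exists_bound_of_continuousOn
    hcont
  refine (hasDerivAt_integral_of_dominated_loc_of_deriv_le (μ := μ) (bound := fun _ => C)
    (F' := fun z (c : Icc (-1 : ℝ) 1) => ((1 - ((c : ℝ) : ℂ) * z) ^ 2)⁻¹)
    (closedBall_mem_nhds z₀ hr) ?_ ?_ ?_ ?_ (integrable_const C) ?_).2.differentiableAt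
    |>.differentiableWithinAt
  · filter_upwards [closedBall_mem_nhds z₀ hr] with z hz
    exact (continuous_div_one_sub_mul (hrU hz)).integrable_of_compactSpace.aestronglyMeasurable
  · exact (continuous_div_one_sub_mul hz₀).integrable_of_compactSpace
  · refine (Continuous.integrable_of_compactSpace ?_).aestronglyMeasurable
    exact Continuous.inv₀ (by fun_prop) fun c => pow_ne_zero 2 (one_sub_mul_ne_zero hz₀ _)
  · exact Eventually.of_forall fun c z hz => hC (c, z) ⟨mem_univ _, hz⟩
  · refine Eventually.of_forall fun c z hz => ?_
    have hne := one_sub_mul_ne_zero (hrU hz) c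
    have h1 : HasDerivAt (fun z : ℂ => 1 - ((c : ℝ) : ℂ) * z) (-((c : ℝ) : ℂ)) z := by
      simpa using ((hasDerivAt_id z).const_mul ((c : ℝ) : ℂ)).const_sub 1
    refine ((hasDerivAt_id z).div h1 hne).congr_deriv ?_
    simp only [id]
    field_simp
    ring

lemma pickTransform_im_nonneg (μ : Measure (Icc (-1 : ℝ) 1)) [IsFiniteMeasure μ] {z : ℂ}
    (hz : 0 < z.im) : 0 ≤ (pickTransform μ z).im := by
  have h := Complex.imCLM.integral_comp_comm
    (continuous_div_one_sub_mul (Or.inl hz)).integrable_of_compactSpace (μ := μ)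
  rw [pickTransform, ← Complex.imCLM_apply, ← h]
  refine integral_nonneg fun c => ?_
  rw [Pi.zero_apply, Complex.imCLM_apply, Complex.div_im]
  have : (z.im * (1 - ((c : ℝ) : ℂ) * z).re / Complex.normSq (1 - ((c : ℝ) : ℂ) * z) -
      z.re * (1 - ((c : ℝ) : ℂ) * z).im / Complex.normSq (1 - ((c : ℝ) : ℂ) * z)) =
      z.im / Complex.normSq (1 - ((c : ℝ) : ℂ) * z) := by
    rw [← sub_div]
    congr 1
    simp
    ring
  rw [this]
  exact div_nonneg hz.le (Complex.normSq_nonneg _)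

lemma pickTransform_ofReal (μ : Measure (Icc (-1 : ℝ) 1)) (x : ℝ) :
    pickTransform μ x = ((∫ c : Icc (-1 : ℝ) 1, x / (1 - c * x) ∂μ : ℝ) : ℂ) := by
  rw [pickTransform, ← integral_complex_ofReal]
  push_cast
  rfl

lemma continuousOn_integral_div_one_sub (μ : Measure (Icc (-1 : ℝ) 1)) [IsFiniteMeasure μ] :
    ContinuousOn (fun x : ℝ => ∫ c : Icc (-1 : ℝ) 1, x / (1 - c * x) ∂μ) (Ioo (-1) 1) := by
  have h := (differentiableOn_pickTransform μ).continuousOn.comp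
    Complex.continuous_ofReal.continuousOn (s := Ioo (-1) 1) fun x hx =>
      Or.inr (by simpa [abs_lt] using hx)
  refine (Complex.continuous_re.comp_continuousOn h).congr fun x _ => ?_
  simp [pickTransform_ofReal]

lemma one_sub_mul_pos {x : ℝ} (hx : x ∈ Ioo (-1 : ℝ) 1) (c : Icc (-1 : ℝ) 1) :
    0 < 1 - (c : ℝ) * x := by
  have h1 := abs_lt.2 hx
  have h2 : |(c : ℝ)| ≤ 1 := abs_le.2 c.2
  have h3 : |(c : ℝ) * x| < 1 := by
    rw [abs_mul]
    nlinarith [abs_nonneg (c : ℝ), abs_nonneg x]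
  linarith [(abs_lt.1 h3).2]

lemma continuous_div_one_sub_real {x : ℝ} (hx : x ∈ Ioo (-1 : ℝ) 1) :
    Continuous fun c : Icc (-1 : ℝ) 1 => x / (1 - c * x) :=
  continuous_const.div (by fun_prop) fun c => (one_sub_mul_pos hx c).ne'

end

section

open MeasureTheory Set Filter Topology Metric
open scoped NNReal

lemma exists_finiteMeasure_tendsto_integral {ι K : Type*} [TopologicalSpace K] [CompactSpace K]
    [T2Space K] [MeasurableSpace K] [BorelSpace K] (u : Ultrafilter ι) (μ : ι → FiniteMeasure K)
    {C : ℝ≥0} (hC : ∀ᶠ i in u, (μ i).mass ≤ C) :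
    ∃ ν : FiniteMeasure K, ∀ g : K → ℝ, Continuous g →
      Tendsto (fun i => ∫ x, g x ∂(μ i : Measure K)) u (𝓝 (∫ x, g x ∂(ν : Measure K))) := by
  obtain ⟨ν, -, hν⟩ := (isCompact_setOfPred_finiteMeasure_le_of_compactSpace K C).ultrafilter_le_nhds
    (u.map μ) (le_principal_iff.2 hC)
  refine ⟨ν, fun g hg => ?_⟩
  exact FiniteMeasure.tendsto_iff_forall_integral_tendsto.1 (show Tendsto μ u (𝓝 ν) from hν)
    (BoundedContinuousFunction.mkOfCompact ⟨g, hg⟩)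

/-- The finite measure `∑ k, w k • δ_{c k}`. -/
noncomputable def sumDirac {n : ℕ} (c : Fin n → Icc (-1 : ℝ) 1) (w : Fin n → ℝ) :
    FiniteMeasure (Icc (-1 : ℝ) 1) :=
  ⟨∑ k, ((w k).toNNReal : ENNReal) • Measure.dirac (c k), ⟨by simp [ENNReal.sum_lt_top]⟩⟩

lemma integral_sumDirac {n : ℕ} (c : Fin n → Icc (-1 : ℝ) 1) {w : Fin n → ℝ}
    (hw : ∀ k, 0 ≤ w k) {g : Icc (-1 : ℝ) 1 → ℝ} (hg : Continuous g) :
    ∫ x, g x ∂(sumDirac c w : Measure (Icc (-1 : ℝ) 1)) = ∑ k, w k * g (c k) := by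
  rw [sumDirac, FiniteMeasure.toMeasure_mk, integral_finsetSum_measure]
  · refine Finset.sum_congr rfl fun k _ => ?_
    simp [NNReal.smul_def, hw k]
  · exact fun k _ => hg.integrable_of_compactSpace.smul_measure ENNReal.coe_ne_top

lemma FiniteMeasure.coe_mass_eq_integral {K : Type*} [MeasurableSpace K] (ν : FiniteMeasure K) :
    (ν.mass : ℝ) = ∫ _ : K, (1 : ℝ) ∂(ν : Measure K) := by
  simp [FiniteMeasure.mass, Measure.real]
  rfl

lemma mass_sumDirac {n : ℕ} (c : Fin n → Icc (-1 : ℝ) 1) {w : Fin n → ℝ} (hw : ∀ k, 0 ≤ w k) :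
    ((sumDirac c w).mass : ℝ) = ∑ k, w k := by
  simp [FiniteMeasure.coe_mass_eq_integral, integral_sumDirac c hw continuous_const]

lemma exists_fin_eq_of_dvd {q : ℚ} (hq : (q : ℝ) ∈ Ioo (-1 : ℝ) 1) {M : ℕ} (hd : q.den ∣ M + 1) :
    ∃ i : Fin (2 * M + 1), (q : ℝ) = ((i : ℝ) - M) / (M + 1) := by
  obtain ⟨k, hk⟩ := hd
  have hk' : (M : ℝ) + 1 = q.den * k := by exact_mod_cast hk
  have hd0 : (0 : ℝ) < q.den := by exact_mod_cast q.den_pos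
  have hM : (0 : ℝ) < M + 1 := by positivity
  have hq' : (q : ℝ) * (M + 1) = ((q.num * k : ℤ) : ℝ) := by
    rw [hk', Rat.cast_def]
    push_cast
    field_simp
  have h1 : -((M : ℤ) + 1) < q.num * k := by
    have : -((M : ℝ) + 1) < ((q.num * k : ℤ) : ℝ) := by rw [← hq']; nlinarith [hq.1]
    exact_mod_cast this
  have h2 : q.num * k < (M : ℤ) + 1 := by
    have : ((q.num * k : ℤ) : ℝ) < (M : ℝ) + 1 := by rw [← hq']; nlinarith [hq.2]
    exact_mod_cast this
  refine ⟨⟨(q.num * k + M).toNat, by omega⟩, ?_⟩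
  have h3 : (((q.num * k + M).toNat : ℤ) : ℝ) = ((q.num * k : ℤ) : ℝ) + M := by
    rw [Int.toNat_of_nonneg (by omega)]; push_cast; rfl
  rw [eq_div_iff hM.ne', hq']
  have h4 : (((q.num * k + M).toNat : ℕ) : ℝ) = ((q.num * k : ℤ) : ℝ) + M := by exact_mod_cast h3
  simp only [h4]
  ring

lemma MatrixMonotoneOn.exists_measure_of_differentiable {f : ℝ → ℝ}
    (hf : MatrixMonotoneOn f (-1) 1) (hd : Differentiable ℝ f) (h0 : f 0 = 0) {B : ℝ}
    (hB : ∀ x ∈ Ioo (-1 : ℝ) 1, deriv f x ≤ B) :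
    ∃ ν : FiniteMeasure (Icc (-1 : ℝ) 1), ∀ x ∈ Ioo (-1 : ℝ) 1,
      f x = ∫ c : Icc (-1 : ℝ) 1, x / (1 - c * x) ∂(ν : Measure (Icc (-1 : ℝ) 1)) := by
  choose c w hc hw hsum happ using hf.exists_approx hd h0 hB
  have hB0 : 0 ≤ B + 1 := le_trans (Finset.sum_nonneg fun k _ => hw 0 k) (hsum 0)
  let N : ℕ → ℕ := fun m => (m + 1).factorial - 1
  have hN : ∀ m, N m + 1 = (m + 1).factorial := fun m =>
    Nat.succ_pred_eq_of_pos (Nat.factorial_pos _)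
  let u : Ultrafilter ℕ := hyperfilter ℕ
  have hu : (u : Filter ℕ) ≤ atTop := Nat.hyperfilter_le_atTop
  obtain ⟨ν, hν⟩ := exists_finiteMeasure_tendsto_integral u
    (fun m => sumDirac (fun k => ⟨c (N m) k, abs_le.1 (hc (N m) k)⟩) (w (N m)))
    (C := (B + 1).toNNReal) (Eventually.of_forall fun m => by
      rw [← NNReal.coe_le_coe, mass_sumDirac _ (hw _), Real.coe_toNNReal _ hB0]
      exact hsum _)
  refine ⟨ν, ?_⟩
  have herr : Tendsto (fun m => (B + 1) * √(8 / ((N m : ℝ) + 1))) atTop (𝓝 0) := by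
    have h1 : Tendsto (fun m => (N m : ℝ) + 1) atTop atTop := by
      refine tendsto_atTop_mono (fun m => ?_) tendsto_natCast_atTop_atTop
      have : m ≤ N m + 1 := by
        rw [hN]; exact (Nat.le_succ m).trans (Nat.self_le_factorial _)
      exact_mod_cast this
    have h2 := ((h1.const_div_atTop 8).sqrt).const_mul (B + 1)
    simpa using h2
  have hrat : ∀ q : ℚ, (q : ℝ) ∈ Ioo (-1 : ℝ) 1 →
      f q = ∫ c : Icc (-1 : ℝ) 1, (q : ℝ) / (1 - c * q) ∂(ν : Measure (Icc (-1 : ℝ) 1)) := by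
    intro q hq
    refine tendsto_nhds_unique (f := fun m => ∑ k, w (N m) k * ((q : ℝ) / (1 - c (N m) k * q)))
      (l := (u : Filter ℕ)) ?_ ?_
    · rw [tendsto_iff_norm_sub_tendsto_zero]
      refine squeeze_zero' (Eventually.of_forall fun _ => norm_nonneg _) ?_ (herr.mono_left hu)
      refine hu ?_
      filter_upwards [eventually_ge_atTop q.den] with m hm
      obtain ⟨i, hi⟩ := exists_fin_eq_of_dvd hq (M := N m) (by
        rw [hN]; exact Nat.dvd_factorial q.den_pos (hm.trans (Nat.le_succ m)))
      rw [norm_sub_rev]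
      exact happ (N m) i q hi
    · refine (hν _ (continuous_div_one_sub_real hq)).congr fun m => ?_
      rw [integral_sumDirac _ (hw _) (continuous_div_one_sub_real hq)]
  have hdense : Ioo (-1 : ℝ) 1 ⊆ closure (Ioo (-1 : ℝ) 1 ∩ range ((↑) : ℚ → ℝ)) :=
    (Rat.denseRange_cast (𝕜 := ℝ)).open_subset_closure_inter isOpen_Ioo
  refine EqOn.of_subset_closure ?_ hd.continuous.continuousOn
    (continuousOn_integral_div_one_sub _) inter_subset_left hdense
  rintro _ ⟨hx, q, rfl⟩
  exact hrat q hx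

lemma mass_le_of_eq_integral {f : ℝ → ℝ} {ν : FiniteMeasure (Icc (-1 : ℝ) 1)}
    (h : ∀ x ∈ Ioo (-1 : ℝ) 1,
      f x = ∫ c : Icc (-1 : ℝ) 1, x / (1 - c * x) ∂(ν : Measure (Icc (-1 : ℝ) 1))) :
    (ν.mass : ℝ) ≤ f (1 / 2) - f (-1 / 2) := by
  have h1 : (1 / 2 : ℝ) ∈ Ioo (-1 : ℝ) 1 := by norm_num
  have h2 : (-1 / 2 : ℝ) ∈ Ioo (-1 : ℝ) 1 := by norm_num
  rw [h _ h1, h _ h2, ← integral_sub (continuous_div_one_sub_real h1).integrable_of_compactSpace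
    (continuous_div_one_sub_real h2).integrable_of_compactSpace]
  rw [FiniteMeasure.coe_mass_eq_integral]
  refine integral_mono (integrable_const _)
    ((continuous_div_one_sub_real h1).sub (continuous_div_one_sub_real h2)).integrable_of_compactSpace
    fun c => ?_
  have p1 := one_sub_mul_pos h1 c
  have p2 := one_sub_mul_pos h2 c
  show (1 : ℝ) ≤ _ - _
  rw [div_sub_div _ _ p1.ne' p2.ne', le_div_iff₀ (by positivity)]
  nlinarith [sq_nonneg (c : ℝ)]

end

section

open MeasureTheory Set Filter Topology Metric ContinuousLinearMap
open scoped NNReal Convolution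

/-- The mollification `x ↦ (φ ⋆ g) ((1 - ρ) x)`, where `ρ` is the radius of the bump `φ`;
on `(-1, 1)` it depends only on the values of `g` on `(-1, 1)`. -/
noncomputable def mollify (φ : ContDiffBump (0 : ℝ)) (g : ℝ → ℝ) (x : ℝ) : ℝ :=
  (φ.normed volume ⋆[lsmul ℝ ℝ, volume] g) ((1 - φ.rOut) * x)

section Mollify

variable {φ : ContDiffBump (0 : ℝ)} {g : ℝ → ℝ} {M : ℝ}

lemma mollify_apply (x : ℝ) :
    mollify φ g x = ∫ t, φ.normed volume t * g ((1 - φ.rOut) * x - t) := by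
  rw [mollify, convolution_lsmul]
  rfl

lemma locallyIntegrable_of_measurable_of_abs_le (hm : Measurable g) (hM : ∀ x, |g x| ≤ M) :
    LocallyIntegrable g :=
  (locallyIntegrable_const M).mono hm.aestronglyMeasurable
    (Eventually.of_forall fun y => (hM y).trans (le_abs_self M))

lemma integrable_normed_mul (hm : Measurable g) (hM : ∀ x, |g x| ≤ M) (y : ℝ) :
    Integrable fun t => φ.normed volume t * g (y - t) :=
  φ.integrable_normed.mul_bdd (c := M)
    (hm.comp (measurable_const.sub measurable_id)).aestronglyMeasurable (Eventually.of_forall fun _ => hM _)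

lemma abs_mollify_le (hM : ∀ x, |g x| ≤ M) (x : ℝ) : |mollify φ g x| ≤ M := by
  rw [mollify_apply]
  refine (norm_integral_le_of_norm_le (g := fun t => φ.normed volume t * M)
    (f := fun t => φ.normed volume t * g ((1 - φ.rOut) * x - t))
    (φ.integrable_normed.mul_const M) (Eventually.of_forall fun t => ?_)).trans_eq ?_
  · rw [norm_mul, Real.norm_of_nonneg (φ.nonneg_normed _)]
    exact mul_le_mul_of_nonneg_left (hM _) (φ.nonneg_normed _)
  · rw [integral_mul_const, φ.integral_normed, one_mul]

lemma contDiff_mollify (hm : Measurable g) (hM : ∀ x, |g x| ≤ M) : ContDiff ℝ 1 (mollify φ g) :=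
  (φ.hasCompactSupport_normed.contDiff_convolution_left (n := 1) (lsmul ℝ ℝ) φ.contDiff_normed
    (locallyIntegrable_of_measurable_of_abs_le hm hM)).comp (contDiff_const.mul contDiff_id)

lemma matrixMonotoneOn_mollify (hg : MatrixMonotoneOn g (-1) 1) (hm : Measurable g)
    (hM : ∀ x, |g x| ≤ M) (hφ : φ.rOut ≤ 1) : MatrixMonotoneOn (mollify φ g) (-1) 1 := by
  have hi := fun x : ℝ => integrable_normed_mul (φ := φ) hm hM ((1 - φ.rOut) * x)
  refine (MatrixMonotoneOn.integral (μ := volume)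
    (g := fun t x => φ.normed volume t * g ((1 - φ.rOut) * x - t))
    (Eventually.of_forall fun t => ?_) fun x _ => hi x).congr fun x _ => (mollify_apply x).symm
  by_cases ht : |t| < φ.rOut
  · refine MatrixMonotoneOn.const_mul ?_ (φ.nonneg_normed t)
    refine hg.comp_affine (m := -t) (sub_nonneg.2 hφ) fun x hx => ?_
    rw [abs_lt] at ht
    constructor <;> nlinarith [hx.1, hx.2]
  · have h0 : φ.normed volume t = 0 := by
      rw [← Function.notMem_support, φ.support_normed_eq]
      simpa using ht
    refine (hg.const_mul le_rfl).congr fun x _ => ?_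
    rw [h0, zero_mul, zero_mul]

lemma tendsto_mollify {ι : Type*} {φ : ι → ContDiffBump (0 : ℝ)} {l : Filter ι}
    (hφ : Tendsto (fun i => (φ i).rOut) l (𝓝 0)) (hm : Measurable g) {x : ℝ}
    (hx : ContinuousAt g x) : Tendsto (fun i => mollify (φ i) g x) l (𝓝 (g x)) := by
  refine ContDiffBump.convolution_tendsto_right hφ
    (Eventually.of_forall fun _ => hm.aestronglyMeasurable) (hx.tendsto.comp tendsto_snd) ?_
  simpa using (hφ.const_sub 1).mul_const x

end Mollify

lemma MatrixMonotoneOn.monotoneOn {f : ℝ → ℝ} {a b : ℝ} (hf : MatrixMonotoneOn f a b) :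
    MonotoneOn f (Ioo a b) := by
  intro x hx y hy hxy
  have hH : ∀ x : ℝ, (Matrix.diagonal fun _ : Fin 1 => (x : ℂ)).IsHermitian := fun x => by
    rw [Matrix.isHermitian_diagonal_iff]; intro i; simp [IsSelfAdjoint]
  have hs : ∀ x ∈ Ioo a b, spectrum ℝ (Matrix.diagonal fun _ : Fin 1 => (x : ℂ)) ⊆ Ioo a b := by
    intro x hx
    have : (Matrix.diagonal fun _ : Fin 1 => (x : ℂ)) = algebraMap ℝ _ x := by
      rw [Matrix.algebraMap_eq_diagonal]; rfl
    rw [this, spectrum.scalar_eq]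
    simpa using hx
  have h := matrixMonotoneOn_iff_cfc.1 hf 1 _ _ (hH x) (hH y) (hs x hx) (hs y hy) (by
    rw [Matrix.diagonal_sub]
    refine Matrix.PosSemidef.diagonal fun i => ?_
    simpa [← Complex.ofReal_sub] using hxy)
  have h00 := h.diag_nonneg (i := 0)
  rw [Matrix.sub_apply, cfc_diagonal_apply (fun _ => y), cfc_diagonal_apply (fun _ => x)] at h00
  simpa [← Complex.ofReal_sub] using h00

lemma MonotoneOn.subset_closure_continuousAt {g : ℝ → ℝ} {a b : ℝ} (hg : MonotoneOn g (Ioo a b)) :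
    Ioo a b ⊆ closure {x ∈ Ioo a b | ContinuousAt g x} := by
  have hc := hg.countable_not_continuousWithinAt
  refine ((hc.dense_compl ℝ).open_subset_closure_inter isOpen_Ioo).trans (closure_mono ?_)
  rintro x ⟨hx, hx'⟩
  refine ⟨hx, ?_⟩
  by_contra h
  exact hx' ⟨hx, fun h' => h (h'.continuousAt (Ioo_mem_nhds hx.1 hx.2))⟩

lemma MonotoneOn.eqOn_of_continuousOn {g h : ℝ → ℝ} {a b : ℝ} (hg : MonotoneOn g (Ioo a b))
    (hh : ContinuousOn h (Ioo a b)) (heq : ∀ x ∈ Ioo a b, ContinuousAt g x → g x = h x) :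
    EqOn g h (Ioo a b) := by
  intro x hx
  have key : ∀ u v, u < v → Ioo u v ⊆ Ioo a b → ∃ y ∈ Ioo u v, g y = h y := by
    intro u v huv hsub
    obtain ⟨z, hz⟩ := nonempty_Ioo.2 huv
    obtain ⟨y, hy, hy'⟩ :=
      mem_closure_iff.1 (hg.subset_closure_continuousAt (hsub hz)) _ isOpen_Ioo hz
    exact ⟨y, hy, heq y hy'.1 hy'.2⟩
  have hhx : Tendsto h (𝓝 x) (𝓝 (h x)) := hh.continuousAt (Ioo_mem_nhds hx.1 hx.2)
  refine le_antisymm (ge_of_tendsto_of_frequently hhx (frequently_iff.2 fun {U} hU => ?_))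
    (le_of_tendsto_of_frequently hhx (frequently_iff.2 fun {U} hU => ?_))
  all_goals obtain ⟨l, u, ⟨hl, hu⟩, hlu⟩ := mem_nhds_iff_exists_Ioo_subset.1 hU
  · obtain ⟨y, hy, hgh⟩ := key x (min u b) (lt_min hu hx.2) fun y hy =>
      ⟨hx.1.trans hy.1, hy.2.trans_le (min_le_right _ _)⟩
    refine ⟨y, hlu ⟨hl.trans hy.1, hy.2.trans_le (min_le_left _ _)⟩, hgh ▸ ?_⟩
    exact hg hx ⟨hx.1.trans hy.1, hy.2.trans_le (min_le_right _ _)⟩ hy.1.le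
  · obtain ⟨y, hy, hgh⟩ := key (max l a) x (max_lt hl hx.1) fun y hy =>
      ⟨(le_max_right _ _).trans_lt hy.1, hy.2.trans hx.2⟩
    refine ⟨y, hlu ⟨(le_max_left _ _).trans_lt hy.1, hy.2.trans hu⟩, hgh ▸ ?_⟩
    exact hg ⟨(le_max_right _ _).trans_lt hy.1, hy.2.trans hx.2⟩ hx hy.2.le

end

section

open MeasureTheory Set Filter Topology Metric
open scoped NNReal

lemma exists_contDiffBump_tendsto_rOut : ∃ φ : ℕ → ContDiffBump (0 : ℝ),
    (∀ n, (φ n).rOut ≤ 1) ∧ Tendsto (fun n => (φ n).rOut) atTop (𝓝 0) :=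
  ⟨fun n => ⟨1 / ((n : ℝ) + 1) / 2, 1 / ((n : ℝ) + 1), by positivity,
    half_lt_self (by positivity)⟩, fun n => by
      show 1 / ((n : ℝ) + 1) ≤ 1
      rw [div_le_one (by positivity)]
      linarith [Nat.cast_nonneg (α := ℝ) n],
    tendsto_one_div_add_atTop_nhds_zero_nat⟩

lemma MatrixMonotoneOn.exists_measure_of_contDiff {f : ℝ → ℝ} (hf : MatrixMonotoneOn f (-1) 1)
    (hd : ContDiff ℝ 1 f) : ∃ ν : FiniteMeasure (Icc (-1 : ℝ) 1), ∀ x ∈ Ioo (-1 : ℝ) 1,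
      f x - f 0 = ∫ c : Icc (-1 : ℝ) 1, x / (1 - c * x) ∂(ν : Measure (Icc (-1 : ℝ) 1)) := by
  obtain ⟨B, hB⟩ := (isCompact_Icc (a := (-1 : ℝ)) (b := 1)).exists_bound_of_continuousOn
    (hd.continuous_deriv le_rfl).continuousOn
  refine ((hf.add_const (-f 0)).congr (g := fun x => f x - f 0)
    fun x _ => (sub_eq_add_neg _ _).symm).exists_measure_of_differentiable
    ((hd.differentiable one_ne_zero).sub_const _) (sub_self _) (B := B) fun x hx => ?_
  rw [deriv_sub_const]
  exact (le_abs_self _).trans (hB x (Ioo_subset_Icc_self hx))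

lemma MatrixMonotoneOn.exists_measure {g : ℝ → ℝ} (hg : MatrixMonotoneOn g (-1) 1)
    (hm : Measurable g) {M : ℝ} (hM : ∀ x, |g x| ≤ M) :
    ∃ (ν : FiniteMeasure (Icc (-1 : ℝ) 1)) (r : ℝ), ∀ x ∈ Ioo (-1 : ℝ) 1,
      g x = r + ∫ c : Icc (-1 : ℝ) 1, x / (1 - c * x) ∂(ν : Measure (Icc (-1 : ℝ) 1)) := by
  obtain ⟨φ, hφ1, hφ0⟩ := exists_contDiffBump_tendsto_rOut
  choose μ hμ using fun n =>
    (matrixMonotoneOn_mollify hg hm hM (hφ1 n)).exists_measure_of_contDiff (contDiff_mollify hm hM)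
  have hbd := fun n x => abs_le.1 (abs_mollify_le (φ := φ n) hM x)
  let u : Ultrafilter ℕ := hyperfilter ℕ
  have hu : (u : Filter ℕ) ≤ atTop := Nat.hyperfilter_le_atTop
  obtain ⟨ν, hν⟩ := exists_finiteMeasure_tendsto_integral u μ (C := (2 * M).toNNReal)
    (Eventually.of_forall fun n => by
      rw [← NNReal.coe_le_coe]
      refine (mass_le_of_eq_integral (hμ n)).trans (le_trans ?_ (Real.le_coe_toNNReal _))
      linarith [(hbd n (1 / 2)).2, (hbd n (-1 / 2)).1])
  obtain ⟨r, -, hr⟩ := (isCompact_Icc (a := -M) (b := M)).ultrafilter_le_nhds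
    (u.map fun n => mollify (φ n) g 0) (le_principal_iff.2 <| mem_map.2 <|
      univ_mem' fun n => hbd n 0)
  refine ⟨ν, r, hg.monotoneOn.eqOn_of_continuousOn
    (continuousOn_const.add (continuousOn_integral_div_one_sub _)) fun x hx hcx => ?_⟩
  refine tendsto_nhds_unique ((tendsto_mollify hφ0 hm hcx).mono_left hu) ?_
  refine (Tendsto.add (show Tendsto _ (u : Filter ℕ) (𝓝 r) from hr)
    (hν _ (continuous_div_one_sub_real hx))).congr fun n => ?_
  rw [← hμ n x hx]
  ring

/-- Bounded measurable matrix monotone functions on an interval are restrictions of Pick functions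
which are holomorphic across the interval. -/
lemma MatrixMonotoneOn.exists_differentiableOn {f : ℝ → ℝ} {a b : ℝ}
    (hf : MatrixMonotoneOn f a b) (hab : a < b) (hm : Measurable ((Ioo a b).domRestrict f))
    (hM : ∃ M : ℝ, ∀ x ∈ Ioo a b, |f x| ≤ M) :
    ∃ (U : Set ℂ) (F : ℂ → ℂ), IsOpen U ∧
      {z : ℂ | 0 < z.im} ∪ (Complex.ofReal '' Ioo a b) ⊆ U ∧ DifferentiableOn ℂ F U ∧
      (∀ x ∈ Ioo a b, F (x : ℂ) = (f x : ℂ)) ∧ ∀ z : ℂ, 0 < z.im → 0 ≤ (F z).im := by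
  obtain ⟨M, hM⟩ := hM
  set m := (a + b) / 2 with hmdef
  set r := (b - a) / 2 with hrdef
  have hr : 0 < r := by rw [hrdef]; linarith
  have hmaps : ∀ x ∈ Ioo (-1 : ℝ) 1, r * x + m ∈ Ioo a b := fun x hx => by
    constructor <;> nlinarith [hx.1, hx.2]
  have hmaps' : ∀ x ∈ Ioo a b, (x - m) / r ∈ Ioo (-1 : ℝ) 1 := fun x hx => by
    rw [mem_Ioo, lt_div_iff₀ hr, div_lt_iff₀ hr]
    constructor <;> linarith [hx.1, hx.2]
  have hind : Measurable ((Ioo a b).indicator f) := by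
    refine measurable_of_restrict_of_restrict_compl (s := Ioo a b) measurableSet_Ioo ?_ ?_
    · exact (funext fun x => indicator_of_mem x.2 f :
        (Ioo a b).domRestrict ((Ioo a b).indicator f) = (Ioo a b).domRestrict f) ▸ hm
    · exact (funext fun x => indicator_of_notMem x.2 f :
        (Ioo a b)ᶜ.domRestrict ((Ioo a b).indicator f) = fun _ => 0) ▸ measurable_const
  have hindM : ∀ x, |(Ioo a b).indicator f x| ≤ M := fun x => by
    by_cases hx : x ∈ Ioo a b
    · simpa [hx] using hM x hx
    · have : (a + b) / 2 ∈ Ioo a b := by constructor <;> linarith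
      simpa [hx] using (abs_nonneg _).trans (hM _ this)
  have hg : MatrixMonotoneOn (fun x => (Ioo a b).indicator f (r * x + m)) (-1) 1 :=
    (hf.congr fun x hx => (indicator_of_mem hx f).symm).comp_affine hr.le hmaps
  obtain ⟨ν, s, hν⟩ := hg.exists_measure (hind.comp (by fun_prop)) fun x => hindM _
  have hlin : Continuous fun z : ℂ => (z - m) / r := by fun_prop
  have him : ∀ z : ℂ, ((z - m) / r).im = z.im / r := fun z => by
    rw [Complex.div_ofReal_im]; simp
  refine ⟨(fun z : ℂ => (z - m) / r) ⁻¹' ({z : ℂ | 0 < z.im} ∪ ball 0 1),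
    fun z => s + pickTransform ν ((z - m) / r),
    isOpen_upperHalfPlane_union_ball.preimage hlin, ?_, ?_, fun x hx => ?_, fun z hz => ?_⟩
  · rintro z (hz | ⟨x, hx, rfl⟩)
    · exact Or.inl (by rw [mem_ofPred_eq, him]; exact div_pos hz hr)
    · refine Or.inr ?_
      have := abs_lt.2 (hmaps' x hx)
      rw [mem_ball_zero_iff]
      beta_reduce
      rw [← Complex.ofReal_sub, ← Complex.ofReal_div, Complex.norm_real]
      exact this
  · exact ((differentiableOn_pickTransform _).comp (f := fun z : ℂ => (z - m) / r)
      (by fun_prop) fun z hz => hz).const_add _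
  · have h1 := hν _ (hmaps' x hx)
    rw [mul_div_cancel₀ _ hr.ne', sub_add_cancel, indicator_of_mem hx] at h1
    simp only
    rw [← Complex.ofReal_sub, ← Complex.ofReal_div, pickTransform_ofReal, h1, Complex.ofReal_add]
  · have h1 := pickTransform_im_nonneg (ν : Measure (Icc (-1 : ℝ) 1))
      (z := (z - m) / r) (by rw [him]; exact div_pos hz hr)
    simpa using h1

lemma analyticAt_of_differentiableOn_of_eq_ofReal {F : ℂ → ℂ} {f : ℝ → ℝ} {U : Set ℂ} {a b x : ℝ}
    (hU : IsOpen U) (hF : DifferentiableOn ℂ F U) (hx : x ∈ Ioo a b) (hxU : (x : ℂ) ∈ U)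
    (h : ∀ y ∈ Ioo a b, F (y : ℂ) = (f y : ℂ)) : AnalyticAt ℝ f x := by
  have h1 : AnalyticAt ℝ F (x : ℂ) :=
    (hF.analyticAt (hU.mem_nhds hxU)).restrictScalars
  have h2 : AnalyticAt ℝ (fun y : ℝ => (F (y : ℂ)).re) x :=
    (Complex.reCLM.analyticAt _).comp (h1.comp (Complex.ofRealCLM.analyticAt x))
  refine h2.congr ?_
  filter_upwards [Ioo_mem_nhds hx.1 hx.2] with y hy
  rw [h y hy, Complex.ofReal_re]

end

/-- **Löwner's theorem.** A bounded Borel function `f : (a, b) → ℝ` is matrix monotone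
if and only if `f` is real analytic and analytically continues to the upper half plane
`Π` as a continuous function `F : Π ∪ (a, b) → closure Π` holomorphic on `Π`. -/
theorem loewner_theorem (a b : ℝ) (hab : a < b) (f : ℝ → ℝ)
    (hf_borel : Measurable ((Set.Ioo a b).restrict f))
    (hf_bdd : ∃ M : ℝ, ∀ x ∈ Set.Ioo a b, |f x| ≤ M) :
    MatrixMonotoneOn f a b ↔
      ((∀ x ∈ Set.Ioo a b, AnalyticAt ℝ f x) ∧
        ∃ F : ℂ → ℂ,
          ContinuousOn F ({z : ℂ | 0 < z.im} ∪ (Complex.ofReal '' Set.Ioo a b)) ∧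
          DifferentiableOn ℂ F {z : ℂ | 0 < z.im} ∧
          (∀ x ∈ Set.Ioo a b, F (x : ℂ) = (f x : ℂ)) ∧
          (∀ z ∈ {z : ℂ | 0 < z.im}, 0 ≤ (F z).im)) := by
  constructor
  · intro hf
    obtain ⟨U, F, hU, hsub, hF, hreal, him⟩ := hf.exists_differentiableOn hab hf_borel hf_bdd
    exact ⟨fun x hx => analyticAt_of_differentiableOn_of_eq_ofReal hU hF hx
      (hsub (Or.inr ⟨x, hx, rfl⟩)) hreal, F, hF.continuousOn.mono hsub,
      hF.mono (Set.subset_union_left.trans hsub), hreal, him⟩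
  · rintro ⟨-, F, hc, hd, hr, hp⟩
    exact matrixMonotoneOn_of_pick_Ioo hab hc hd hr hp
end

section
/- The Schur complement is matrix monotone on positive definite block $2 \times 2$ Hermitian matrices: let $A$ and $B$ be Hermitian complex matrices written in block form $A = \begin{pmatrix} A_{11} & A_{12} \\ A_{21} & A_{22} \end{pmatrix}$, $B = \begin{pmatrix} B_{11} & B_{12} \\ B_{21} & B_{22} \end{pmatrix}$ (with $A_{11}, B_{11}$ square of the same size and $A_{22}, B_{22}$ square of the same size). If $A$ and $B$ are positive definite and $B - A$ is positive semidefinite, then $(B_{11} - B_{12} B_{22}^{-1} B_{21}) - (A_{11} - A_{12} A_{22}^{-1} A_{21})$ is positive semidefinite. -/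
open Matrix
open scoped ComplexOrder

/-- Completing the square: the compression of a Hermitian block matrix to the graph of `Y` is its
Schur complement plus a square. -/
theorem Matrix.IsHermitian.conjTranspose_fromRows_one_mul_fromBlocks_mul
    {m k R : Type*} [Fintype m] [Fintype k] [DecidableEq m] [DecidableEq k]
    [CommRing R] [StarRing R]
    {A : Matrix m m R} {B : Matrix m k R} {C : Matrix k m R} {D : Matrix k k R}
    (hM : (Matrix.fromBlocks A B C D).IsHermitian) (hD : IsUnit D) (Y : Matrix k m R) :
    (fromRows (1 : Matrix m m R) Y)ᴴ * Matrix.fromBlocks A B C D *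
        fromRows (1 : Matrix m m R) Y =
      A - B * D⁻¹ * C + (Y + D⁻¹ * C)ᴴ * D * (Y + D⁻¹ * C) := by
  obtain ⟨-, -, hC, hDH⟩ := isHermitian_fromBlocks_iff.mp hM
  have hdet := (isUnit_iff_isUnit_det D).mp hD
  rw [conjTranspose_fromRows_eq_fromCols_conjTranspose, fromCols_mul_fromBlocks,
    fromCols_mul_fromRows, conjTranspose_add, conjTranspose_mul,
    conjTranspose_nonsing_inv, hC, hDH.eq, conjTranspose_one]
  simp only [Matrix.add_mul, Matrix.mul_add, Matrix.one_mul, Matrix.mul_one, Matrix.mul_assoc,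
    mul_nonsing_inv_cancel_left _ _ hdet, nonsing_inv_mul_cancel_left _ _ hdet]
  abel

/-- The lower-right block of a positive definite block matrix is positive definite. -/
theorem Matrix.PosDef.of_fromBlocks₂₂ {m k R : Type*} [CommRing R] [PartialOrder R] [StarRing R]
    {A : Matrix m m R} {B : Matrix m k R} {C : Matrix k m R} {D : Matrix k k R}
    (hM : (fromBlocks A B C D).PosDef) : D.PosDef :=
  hM.submatrix Sum.inr_injective

/-- **Monotonicity of the Schur complement.** If `A ≤ B` are positive definite
Hermitian block `2 × 2` matrices, then the Schur complement of `A` is dominated by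
the Schur complement of `B`. -/
theorem schurComplement_monotone {m k : Type*} [Fintype m] [Fintype k]
    [DecidableEq m] [DecidableEq k]
    (A₁₁ B₁₁ : Matrix m m ℂ) (A₁₂ B₁₂ : Matrix m k ℂ)
    (A₂₁ B₂₁ : Matrix k m ℂ) (A₂₂ B₂₂ : Matrix k k ℂ)
    (hA : (Matrix.fromBlocks A₁₁ A₁₂ A₂₁ A₂₂).PosDef)
    (hB : (Matrix.fromBlocks B₁₁ B₁₂ B₂₁ B₂₂).PosDef)
    (hAB : (Matrix.fromBlocks B₁₁ B₁₂ B₂₁ B₂₂ - Matrix.fromBlocks A₁₁ A₁₂ A₂₁ A₂₂).PosSemidef) :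
    ((B₁₁ - B₁₂ * B₂₂⁻¹ * B₂₁) - (A₁₁ - A₁₂ * A₂₂⁻¹ * A₂₁)).PosSemidef := by
  have hA₂₂ := hA.of_fromBlocks₂₂
  have hB₂₂ := hB.of_fromBlocks₂₂
  have key := (hAB.conjTranspose_mul_mul_same
    (fromRows (1 : Matrix m m ℂ) (-(B₂₂⁻¹ * B₂₁)))).add
      (hA₂₂.posSemidef.conjTranspose_mul_mul_same (-(B₂₂⁻¹ * B₂₁) + A₂₂⁻¹ * A₂₁))
  rw [Matrix.mul_sub, Matrix.sub_mul,
    hA.isHermitian.conjTranspose_fromRows_one_mul_fromBlocks_mul hA₂₂.isUnit,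
    hB.isHermitian.conjTranspose_fromRows_one_mul_fromBlocks_mul hB₂₂.isUnit,
    neg_add_cancel (B₂₂⁻¹ * B₂₁), Matrix.mul_zero, add_zero] at key
  convert key using 1
  abel
end

section
/- The Schur complement maps the noncommutative upper half plane of block $2 \times 2$ matrices into the noncommutative upper half plane: let $X = \begin{pmatrix} X_{11} & X_{12} \\ X_{21} & X_{22} \end{pmatrix}$ be a block $2 \times 2$ complex matrix (with $X_{11}$ and $X_{22}$ square) such that $\operatorname{Im} X = (X - X^*)/(2i)$ is positive definite. Then $X_{22}$ is invertible and $\operatorname{Im}(X_{11} - X_{12} X_{22}^{-1} X_{21})$ is positive definite. -/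
open Matrix
open scoped ComplexOrder

/-- The imaginary part of a square complex matrix: `Im Y = (Y - Y*)/(2i)`. -/
noncomputable def matImPart {n : Type*} (Y : Matrix n n ℂ) : Matrix n n ℂ :=
  (2 * Complex.I)⁻¹ • (Y - Yᴴ)

/-- Congruence by a rectangular matrix commutes with taking the imaginary part. -/
theorem matImPart_conjTranspose_mul_mul {m n : Type*} [Fintype n]
    (Y : Matrix n n ℂ) (B : Matrix n m ℂ) :
    matImPart (Bᴴ * Y * B) = Bᴴ * matImPart Y * B := by
  simp only [matImPart, conjTranspose_mul, conjTranspose_conjTranspose, Matrix.mul_smul,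
    Matrix.smul_mul, Matrix.mul_sub, Matrix.sub_mul, Matrix.mul_assoc]

/-- A matrix with positive definite imaginary part is invertible. -/
theorem isUnit_of_posDef_matImPart {n : Type*} [Fintype n] [DecidableEq n] {Y : Matrix n n ℂ}
    (hY : (matImPart Y).PosDef) : IsUnit Y := by
  rw [← mulVec_injective_iff_isUnit, ← coe_mulVecLin, injective_iff_map_eq_zero]
  intro v hv
  rw [mulVecLin_apply] at hv
  by_contra hne
  have hpos := hY.dotProduct_mulVec_pos hne
  have hzero : star v ⬝ᵥ (Yᴴ *ᵥ v) = 0 := by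
    rw [dotProduct_mulVec, ← star_mulVec, hv, star_zero, zero_dotProduct]
  rw [matImPart, smul_mulVec, sub_mulVec, hv, zero_sub, dotProduct_smul, dotProduct_neg, hzero,
    neg_zero, smul_zero] at hpos
  exact lt_irrefl _ hpos

/-- **The Schur complement maps the noncommutative upper half plane into the
noncommutative upper half plane.** If `X` is a block `2 × 2` complex matrix with
`Im X` positive definite, then `X₂₂` is invertible and the imaginary part of the
Schur complement `X₁₁ - X₁₂ X₂₂⁻¹ X₂₁` is positive definite. -/
theorem schurComplement_maps_UHP_to_UHP {m k : Type*} [Fintype m] [Fintype k]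
    [DecidableEq m] [DecidableEq k]
    (X₁₁ : Matrix m m ℂ) (X₁₂ : Matrix m k ℂ) (X₂₁ : Matrix k m ℂ) (X₂₂ : Matrix k k ℂ)
    (hX : (matImPart (Matrix.fromBlocks X₁₁ X₁₂ X₂₁ X₂₂)).PosDef) :
    IsUnit X₂₂ ∧ (matImPart (X₁₁ - X₁₂ * X₂₂⁻¹ * X₂₁)).PosDef := by
  have h₂₂ : IsUnit X₂₂ := by
    have h : (matImPart (fromBlocks X₁₁ X₁₂ X₂₁ X₂₂)).submatrix Sum.inr Sum.inr =
        matImPart X₂₂ := by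
      ext i j
      simp [matImPart]
    exact isUnit_of_posDef_matImPart (h ▸ hX.submatrix Sum.inr_injective)
  refine ⟨h₂₂, ?_⟩
  set B : Matrix (m ⊕ k) m ℂ := fromRows 1 (-(X₂₂⁻¹ * X₂₁)) with hB
  have hBinj : Function.Injective B.mulVec := fun v w hvw ↦ by
    funext i
    simpa [hB, fromRows_mulVec] using congrFun hvw (Sum.inl i)
  have hmul : Bᴴ * fromBlocks X₁₁ X₁₂ X₂₁ X₂₂ * B = X₁₁ - X₁₂ * X₂₂⁻¹ * X₂₁ := by
    have hcancel : X₂₂ * (X₂₂⁻¹ * X₂₁) = X₂₁ :=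
      mul_nonsing_inv_cancel_left _ _ ((isUnit_iff_isUnit_det _).mp h₂₂)
    rw [Matrix.mul_assoc, hB, fromBlocks_mul_fromRows,
      conjTranspose_fromRows_eq_fromCols_conjTranspose, fromCols_mul_fromRows]
    simp [hcancel, Matrix.mul_assoc, sub_eq_add_neg]
  rw [← hmul, matImPart_conjTranspose_mul_mul]
  exact hX.conjTranspose_mul_mul_same hBinj
end
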